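/- arXiv:2410.01234 — 2 statements merged into one kernel-verified Lean document; each statement's English description precedes it below -/
import Mathlib

section
/- Let d ≥ 2, q ≥ 2, J > 0, and consider the nearest-neighbour couplings J_{xy} = J if |x−y| = 1 and J_{xy} = 0 otherwise. Let h = (h_{x,n})_{x∈ℤ^d, n∈ZMod q} be a family of nonnegative real numbers. (i) If there exist h* ≥ 0 and δ > 1 such that h_{x,n} ≤ h*/|x|^δ for every x ≠ 0 and every n ∈ ZMod q, then there exists β₀ > 0 such that for every β > β₀ the nearest-neighbour Potts model with external field h undergoes phase transition: the set 𝒢_{β,h} of all weak cluster points of the nets of finite-volume Gibbs measures, over all boundary conditions, contains at least two distinct probability measures. (ii) If instead h_{x,n} ≤ h*/|x| for every x ≠ 0 and n, then there exists h₀ > 0 such that the same conclusion holds for all h* ≤ h₀ and all β large enough. -/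
open scoped BigOperators
open Filter MeasureTheory

noncomputable section

/-- The lattice `ℤ^d`. -/
abbrev Zd (d : ℕ) := Fin d → ℤ

/-- The ℓ¹-norm on `ℤ^d`. -/
def l1 {d : ℕ} (x : Zd d) : ℤ := ∑ i, |x i|

/-- The configuration in `Ω_Λ^η` determined by `σ : Λ → ZMod q` (boundary condition `η`). -/
def extendCfg {d q : ℕ} (Λ : Finset (Zd d)) (η : Zd d → ZMod q) (σ : Λ → ZMod q) :
    Zd d → ZMod q :=
  fun x => if hx : x ∈ Λ then σ ⟨x, hx⟩ else η x

/-- The Potts Hamiltonian with external field `h` and boundary condition `η`: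
`H^η_{Λ,h}(σ) = -∑_{{x,y}⊆Λ} J_{xy}·𝟙[σ_x=σ_y] - ∑_{x∈Λ}∑_{y∉Λ} J_{xy}·𝟙[σ_x=η_y] - ∑_{x∈Λ} h_{x,σ_x}`.
(The sum over unordered pairs is half the sum over ordered pairs, the diagonal
being irrelevant since `J_{xx} = 0` for the couplings considered.) -/
noncomputable def pottsHam (d q : ℕ) (Jc : Zd d → Zd d → ℝ) (h : Zd d → ZMod q → ℝ)
    (Λ : Finset (Zd d)) (η : Zd d → ZMod q) (σ : Zd d → ZMod q) : ℝ :=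
  -(1 / 2) * (∑ x ∈ Λ, ∑ y ∈ Λ, Jc x y * (if σ x = σ y then 1 else 0))
    - ∑ x ∈ Λ, ∑' y : Zd d, (if y ∈ Λ then 0 else Jc x y * (if σ x = η y then 1 else 0))
    - ∑ x ∈ Λ, h x (σ x)

/-- Gibbs weight: the probability of the configuration `σ` under `μ^η_{Λ,β,h}`. -/
noncomputable def pottsWeight (d q : ℕ) [NeZero q] (Jc : Zd d → Zd d → ℝ) (β : ℝ)
    (h : Zd d → ZMod q → ℝ) (Λ : Finset (Zd d)) (η : Zd d → ZMod q) (σ : Λ → ZMod q) : ℝ :=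
  Real.exp (-(β * pottsHam d q Jc h Λ η (extendCfg Λ η σ)))
    / ∑ ω : Λ → ZMod q, Real.exp (-(β * pottsHam d q Jc h Λ η (extendCfg Λ η ω)))

lemma pottsWeight_sum (d q : ℕ) [NeZero q] (Jc : Zd d → Zd d → ℝ) (β : ℝ)
    (h : Zd d → ZMod q → ℝ) (Λ : Finset (Zd d)) (η : Zd d → ZMod q) :
    ∑ σ : Λ → ZMod q, pottsWeight d q Jc β h Λ η σ = 1 := by
  have hZ : 0 < ∑ ω : Λ → ZMod q,
      Real.exp (-(β * pottsHam d q Jc h Λ η (extendCfg Λ η ω))) :=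
    Finset.sum_pos (fun _ _ => Real.exp_pos _) Finset.univ_nonempty
  simp only [pottsWeight, ← Finset.sum_div]
  exact div_self hZ.ne'

/-- The finite-volume Gibbs measure `μ^η_{Λ,β,h}` of the Potts model with external
field `h` and boundary condition `η`, as a Borel probability measure on
`Ω = (ℤ^d → ZMod q)` supported on `Ω_Λ^η`. -/
noncomputable def pottsGibbsPM (d q : ℕ) [NeZero q] (Jc : Zd d → Zd d → ℝ) (β : ℝ)
    (h : Zd d → ZMod q → ℝ) (Λ : Finset (Zd d)) (η : Zd d → ZMod q) :
    ProbabilityMeasure (Zd d → ZMod q) :=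
  ⟨∑ σ : Λ → ZMod q, (ENNReal.ofReal (pottsWeight d q Jc β h Λ η σ)) •
      Measure.dirac (extendCfg Λ η σ), by
    constructor
    rw [Measure.coe_finset_sum]
    simp only [Finset.sum_apply, Measure.smul_apply, smul_eq_mul, measure_univ, mul_one]
    rw [← ENNReal.ofReal_sum_of_nonneg (fun σ _ => by unfold pottsWeight; positivity),
      pottsWeight_sum, ENNReal.ofReal_one]⟩

/-- `𝒢_{β,h}`: the set of all weak cluster points, over all boundary conditions `η`, of
the nets `Λ ↦ μ^η_{Λ,β,h}` of finite-volume Gibbs measures (indexed by the finite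
subsets of `ℤ^d` directed by inclusion). -/
def gibbsClusterSet (d q : ℕ) [NeZero q] (Jc : Zd d → Zd d → ℝ) (β : ℝ)
    (h : Zd d → ZMod q → ℝ) : Set (ProbabilityMeasure (Zd d → ZMod q)) :=
  {μ | ∃ η : Zd d → ZMod q,
    MapClusterPt μ atTop (fun Λ : Finset (Zd d) => pottsGibbsPM d q Jc β h Λ η)}

/-- Nearest-neighbour couplings: `J_{xy} = J` if `|x-y| = 1` and `0` otherwise. -/
noncomputable def JcoupNN (d : ℕ) (J : ℝ) (x y : Zd d) : ℝ :=
  if l1 (x - y) = 1 then J else 0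


/-- The `i`-th unit vector of `ℤ^d`. -/
def unitVec {d : ℕ} (i : Fin d) : Zd d := Pi.single i 1

lemma unitVec_same {d : ℕ} (i : Fin d) : unitVec i i = 1 := by simp [unitVec]

lemma unitVec_of_ne {d : ℕ} {i j : Fin d} (h : j ≠ i) : unitVec i j = 0 := by
  simp [unitVec, h]

lemma l1_nonneg {d : ℕ} (x : Zd d) : 0 ≤ l1 x := Finset.sum_nonneg fun _ _ => abs_nonneg _

lemma abs_apply_le_l1 {d : ℕ} (x : Zd d) (i : Fin d) : |x i| ≤ l1 x :=
  Finset.single_le_sum (f := fun i => |x i|) (fun _ _ => abs_nonneg _) (Finset.mem_univ i)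

lemma l1_sub_unitVec {d : ℕ} (x : Zd d) (i : Fin d) :
    l1 (x - unitVec i) = l1 x - |x i| + |x i - 1| := by
  have h1 : l1 x = |x i| + ∑ j ∈ Finset.univ.erase i, |x j| :=
    (Finset.add_sum_erase _ (fun j => |x j|) (Finset.mem_univ i)).symm
  have h2 : l1 (x - unitVec i) = |x i - 1| + ∑ j ∈ Finset.univ.erase i, |x j| := by
    unfold l1
    rw [← Finset.add_sum_erase _ _ (Finset.mem_univ i)]
    congr 1
    · simp [unitVec_same]
    · refine Finset.sum_congr rfl fun j hj => ?_
      simp [unitVec_of_ne (Finset.ne_of_mem_erase hj)]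
  omega

lemma l1_unitVec {d : ℕ} (i : Fin d) : l1 (unitVec i) = 1 := by
  have h := l1_sub_unitVec (unitVec i) i
  simp only [sub_self, unitVec_same] at h
  simp only [l1, Pi.zero_apply] at h ⊢
  simp at h
  omega

/-- A bounded flow on the edges `(x, x + e_i)` of `ℤ^d` whose divergence dominates `1 / (|x| + 1)`. -/
def radialFlow {d : ℕ} (i : Fin d) (x : Zd d) : ℝ :=
  if 0 ≤ x i then ((x i : ℝ) + 1) / ((l1 x : ℝ) + 1) else (x i : ℝ) / (l1 x : ℝ)

lemma abs_radialFlow_le {d : ℕ} (i : Fin d) (x : Zd d) : |radialFlow i x| ≤ 1 := by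
  have h := abs_apply_le_l1 x i
  have hn := l1_nonneg x
  unfold radialFlow
  split_ifs with hx
  · rw [abs_of_nonneg hx] at h
    have h' : (x i : ℝ) ≤ l1 x := by exact_mod_cast h
    have hx' : (0 : ℝ) ≤ x i := by exact_mod_cast hx
    rw [abs_of_nonneg (by positivity), div_le_one (by positivity)]
    linarith
  · have h' : |(x i : ℝ)| ≤ l1 x := by exact_mod_cast h
    rw [abs_div, abs_of_nonneg (a := (l1 x : ℝ)) (by exact_mod_cast hn)]
    exact div_le_one_of_le₀ h' (by exact_mod_cast hn)

lemma radialFlow_sub_ge {d : ℕ} (i : Fin d) (x : Zd d) :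
    (|(x i : ℝ)| + 1) / ((l1 x : ℝ) + 1) - |(x i : ℝ)| / (l1 x : ℝ) ≤
      radialFlow i x - radialFlow i (x - unitVec i) := by
  have hl := l1_sub_unitVec x i
  have hn := l1_nonneg x
  have hn' : (0 : ℝ) ≤ l1 x := by exact_mod_cast hn
  have hxi : (x - unitVec i) i = x i - 1 := by simp [unitVec_same]
  rcases lt_trichotomy (x i) 0 with hx | hx | hx
  · have e : l1 (x - unitVec i) = l1 x + 1 := by
      rw [hl, abs_of_neg hx, abs_of_neg (by omega)]; ring
    have hx' : (x i : ℝ) < 0 := by exact_mod_cast hx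
    rw [radialFlow, radialFlow, if_neg (by omega), if_neg (by rw [hxi]; omega), hxi, e,
      abs_of_neg hx']
    push_cast
    apply le_of_eq
    ring
  · have e : l1 (x - unitVec i) = l1 x + 1 := by rw [hl, hx]; simp
    rw [radialFlow, radialFlow, if_pos hx.ge, if_neg (by rw [hxi]; omega), hxi, e, hx]
    push_cast
    simp only [abs_zero, zero_add, zero_div, sub_zero, neg_div, sub_neg_eq_add]
    have : 0 ≤ 1 / ((l1 x : ℝ) + 1) := by positivity
    linarith
  · have e : l1 (x - unitVec i) = l1 x - 1 := by
      rw [hl, abs_of_pos hx, abs_of_nonneg (by omega)]; ring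
    have hx' : (0 : ℝ) < x i := by exact_mod_cast hx
    rw [radialFlow, radialFlow, if_pos hx.le, if_pos (by rw [hxi]; omega), hxi, e,
      abs_of_pos hx']
    push_cast
    apply le_of_eq
    ring

lemma one_div_le_sum_radialFlow_sub {d : ℕ} (hd : 2 ≤ d) (x : Zd d) :
    1 / ((l1 x : ℝ) + 1) ≤ ∑ i, (radialFlow i x - radialFlow i (x - unitVec i)) := by
  refine le_trans ?_ (Finset.sum_le_sum fun i _ => radialFlow_sub_ge i x)
  have hs : ∑ i, |(x i : ℝ)| = l1 x := by simp [l1]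
  have hd' : (2 : ℝ) ≤ d := by exact_mod_cast hd
  have hn' : (0 : ℝ) ≤ l1 x := by exact_mod_cast l1_nonneg x
  rw [Finset.sum_sub_distrib, ← Finset.sum_div, ← Finset.sum_div, Finset.sum_add_distrib, hs]
  simp only [Finset.sum_const, Finset.card_univ, Fintype.card_fin, nsmul_eq_mul, mul_one]
  have h1 : (l1 x : ℝ) / l1 x ≤ 1 := div_self_le_one _
  have h2 : ((l1 x : ℝ) + d) / (l1 x + 1) = 1 + (d - 1) / ((l1 x : ℝ) + 1) := by
    field_simp; ring
  have h3 : 1 / ((l1 x : ℝ) + 1) ≤ (d - 1) / ((l1 x : ℝ) + 1) := by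
    gcongr; linarith
  linarith

/-- Isoperimetric-type inequality for the weight `1 / (|x| + 1)`: if all edges between `I` and its
complement have their base point in `A`, then the mass of `I` is at most `d * |A|`. -/
lemma sum_one_div_l1_le {d : ℕ} (hd : 2 ≤ d) (I A : Finset (Zd d))
    (hA : ∀ x i, x ∉ A → (x ∈ I ↔ x + unitVec i ∈ I)) :
    ∑ x ∈ I, 1 / ((l1 x : ℝ) + 1) ≤ d * (A.card : ℝ) := by
  refine (Finset.sum_le_sum fun x _ => one_div_le_sum_radialFlow_sub hd x).trans ?_
  rw [Finset.sum_comm]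
  have key : ∀ i : Fin d, ∑ x ∈ I, (radialFlow i x - radialFlow i (x - unitVec i)) ≤ A.card := by
    intro i
    set I' := I.image (fun x => x - unitVec i) with hI'
    have memI' : ∀ x, x ∈ I' ↔ x + unitVec i ∈ I := by
      intro x
      simp only [hI', Finset.mem_image]
      constructor
      · rintro ⟨y, hy, rfl⟩; simpa using hy
      · intro h; exact ⟨_, h, by simp⟩
    have hsum : ∑ x ∈ I, radialFlow i (x - unitVec i) = ∑ x ∈ I', radialFlow i x := by
      rw [hI', Finset.sum_image]
      intro a _ b _ h; simpa using h
    have hdiff : I \ A = I' \ A := by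
      ext x
      simp only [Finset.mem_sdiff, memI']
      constructor
      · rintro ⟨h, h'⟩; exact ⟨(hA x i h').1 h, h'⟩
      · rintro ⟨h, h'⟩; exact ⟨(hA x i h').2 h, h'⟩
    have s1 := Finset.sum_inter_add_sum_sdiff I A (radialFlow i)
    have s2 := Finset.sum_inter_add_sum_sdiff I' A (radialFlow i)
    rw [Finset.sum_sub_distrib, hsum, ← s1, ← s2, hdiff]
    rw [Finset.inter_comm I, Finset.inter_comm I', ← Finset.filter_mem_eq_inter,
      ← Finset.filter_mem_eq_inter, Finset.sum_filter, Finset.sum_filter]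
    have : ∑ a ∈ A, (if a ∈ I then radialFlow i a else 0) -
        ∑ a ∈ A, (if a ∈ I' then radialFlow i a else 0) ≤ A.card := by
      rw [← Finset.sum_sub_distrib]
      refine (Finset.sum_le_card_nsmul A _ 1 fun x _ => ?_).trans (by simp)
      have := abs_le.1 (abs_radialFlow_le i x)
      split_ifs <;> linarith
    linarith
  exact (Finset.sum_le_sum fun i _ => key i).trans (by simp)


/-- The cube `{-N, …, N}^d`. -/
def box (d N : ℕ) : Finset (Zd d) := Fintype.piFinset fun _ => Finset.Icc (-(N : ℤ)) N

lemma mem_box {d N : ℕ} {x : Zd d} : x ∈ box d N ↔ ∀ i, |x i| ≤ N := by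
  simp [box, Fintype.mem_piFinset, abs_le]

/-- The vertex sets visited by walks of length `m` with steps in `{-1, 0, 1}^d` starting at `v`. -/
def walkRanges (d : ℕ) : ℕ → Zd d → Finset (Finset (Zd d))
  | 0, v => {{v}}
  | m + 1, v => (box d 1).biUnion fun s => (walkRanges d m (v + s)).image (insert v)

lemma card_walkRanges_le (d m : ℕ) (v : Zd d) : (walkRanges d m v).card ≤ (3 ^ d) ^ m := by
  induction m generalizing v with
  | zero => simp [walkRanges]
  | succ m ih =>
    have hc : (box d 1).card = 3 ^ d := by simp [box, Fintype.card_piFinset]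
    rw [walkRanges, pow_succ']
    refine Finset.card_biUnion_le.trans ?_
    refine (Finset.sum_le_card_nsmul _ _ ((3 ^ d) ^ m) fun s _ => ?_).trans ?_
    · exact Finset.card_image_le.trans (ih _)
    · rw [hc, smul_eq_mul]

lemma start_mem_of_mem_walkRanges {d m : ℕ} {v : Zd d} {A : Finset (Zd d)}
    (h : A ∈ walkRanges d m v) : v ∈ A := by
  cases m with
  | zero => simp_all [walkRanges]
  | succ m =>
    simp only [walkRanges, Finset.mem_biUnion, Finset.mem_image] at h
    obtain ⟨s, -, B, -, rfl⟩ := h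
    simp

lemma neg_mem_box {d N : ℕ} {s : Zd d} (hs : s ∈ box d N) : -s ∈ box d N := by
  simpa [mem_box] using hs

lemma insert_mem_walkRanges {d m : ℕ} {v b s : Zd d} {A : Finset (Zd d)}
    (hA : A ∈ walkRanges d m v) (hb : b ∈ A) (hs : s ∈ box d 1) :
    insert (b + s) A ∈ walkRanges d (m + 2) v := by
  have detour : ∀ B ∈ walkRanges d m v, insert (v + s) B ∈ walkRanges d (m + 2) v := by
    intro B hB
    have hv := start_mem_of_mem_walkRanges hB
    simp only [walkRanges, Finset.mem_biUnion, Finset.mem_image]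
    refine ⟨s, hs, insert (v + s) B, ⟨-s, neg_mem_box hs, B, by simpa using hB, rfl⟩, ?_⟩
    exact Finset.insert_eq_self.2 (Finset.mem_insert_of_mem hv)
  induction m generalizing v A with
  | zero =>
    have : A = {v} := by simpa [walkRanges] using hA
    subst this
    obtain rfl : b = v := by simpa using hb
    exact detour _ hA
  | succ m ih =>
    by_cases hbv : b = v
    · subst hbv; exact detour _ hA
    have hA' := hA
    simp only [walkRanges, Finset.mem_biUnion, Finset.mem_image] at hA'
    obtain ⟨r, hr, B, hB, rfl⟩ := hA'
    have hbB : b ∈ B := by simpa [hbv] using hb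
    rw [walkRanges]
    simp only [Finset.mem_biUnion, Finset.mem_image]
    refine ⟨r, hr, insert (b + s) B, ih hB hbB ?_, Finset.insert_comm _ _ _⟩
    intro C hC
    have hv := start_mem_of_mem_walkRanges hC
    simp only [walkRanges, Finset.mem_biUnion, Finset.mem_image]
    refine ⟨s, hs, insert (v + r + s) C, ⟨-s, neg_mem_box hs, C, by simpa using hC, rfl⟩, ?_⟩
    exact Finset.insert_eq_self.2 (Finset.mem_insert_of_mem hv)

/-- The steps of paths in `B` that are connected for the sup-distance. -/
def kingStep {d : ℕ} (B : Finset (Zd d)) (x y : Zd d) : Prop := y ∈ B ∧ y - x ∈ box d 1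

open Classical in
/-- The sup-distance connected component of `v` in `B`. -/
def kingComp {d : ℕ} (B : Finset (Zd d)) (v : Zd d) : Finset (Zd d) :=
  B.filter fun x => Relation.ReflTransGen (kingStep B) v x

lemma mem_kingComp {d : ℕ} {B : Finset (Zd d)} {v x : Zd d} :
    x ∈ kingComp B v ↔ x ∈ B ∧ Relation.ReflTransGen (kingStep B) v x := by
  simp [kingComp]

lemma self_mem_kingComp {d : ℕ} {B : Finset (Zd d)} {v : Zd d} (h : v ∈ B) : v ∈ kingComp B v :=
  mem_kingComp.2 ⟨h, .refl⟩

lemma mem_kingComp_of_near {d : ℕ} {B : Finset (Zd d)} {v x y : Zd d} (hx : x ∈ kingComp B v)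
    (hy : y ∈ B) (hxy : y - x ∈ box d 1) : y ∈ kingComp B v :=
  mem_kingComp.2 ⟨hy, (mem_kingComp.1 hx).2.tail ⟨hy, hxy⟩⟩

lemma kingComp_eq_of_mem {d : ℕ} {B : Finset (Zd d)} {v w : Zd d} (hv : v ∈ B)
    (hw : w ∈ kingComp B v) : kingComp B w = kingComp B v := by
  have hvw := (mem_kingComp.1 hw).2
  have hwv : Relation.ReflTransGen (kingStep B) w v := by
    have aux : ∀ x, Relation.ReflTransGen (kingStep B) v x →
        x ∈ B ∧ Relation.ReflTransGen (kingStep B) x v := by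
      intro x hx
      induction hx with
      | refl => exact ⟨hv, .refl⟩
      | tail _ hyz ih =>
        refine ⟨hyz.1, .head ⟨ih.1, ?_⟩ ih.2⟩
        rw [← neg_sub]; exact neg_mem_box hyz.2
    exact (aux w hvw).2
  ext x
  simp only [mem_kingComp]
  exact and_congr_right fun _ => ⟨fun h => hvw.trans h, fun h => hwv.trans h⟩

lemma kingComp_mem_walkRanges {d : ℕ} {B : Finset (Zd d)} {v : Zd d} (hv : v ∈ B) :
    kingComp B v ∈ walkRanges d (2 * ((kingComp B v).card - 1)) v := by
  have grow : ∀ k, k + 1 ≤ (kingComp B v).card →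
      ∃ C ∈ walkRanges d (2 * k) v, C ⊆ kingComp B v ∧ C.card = k + 1 := by
    intro k
    induction k with
    | zero =>
      intro _
      exact ⟨{v}, by simp [walkRanges], by simpa using self_mem_kingComp hv, by simp⟩
    | succ k ih =>
      intro hk
      obtain ⟨C, hC, hsub, hcard⟩ := ih (by omega)
      have hex : ∃ b ∈ C, ∃ y, y ∉ C ∧ kingStep B b y := by
        by_contra! hcon
        have hall : ∀ x, Relation.ReflTransGen (kingStep B) v x → x ∈ C := by
          intro x hx
          induction hx with
          | refl => exact start_mem_of_mem_walkRanges hC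
          | tail _ hyz ih =>
            by_contra hz
            exact hcon _ ih _ hz hyz
        have : kingComp B v ⊆ C := fun x hx => hall x (mem_kingComp.1 hx).2
        have := Finset.card_le_card this
        omega
      obtain ⟨b, hb, y, hy, hby⟩ := hex
      refine ⟨insert y C, ?_, ?_, ?_⟩
      · have := insert_mem_walkRanges hC hb hby.2
        simpa [mul_add] using this
      · exact Finset.insert_subset (mem_kingComp_of_near (hsub hb) hby.1 hby.2) hsub
      · rw [Finset.card_insert_of_notMem hy, hcard]
  have hpos : 0 < (kingComp B v).card := Finset.card_pos.2 ⟨v, self_mem_kingComp hv⟩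
  obtain ⟨C, hC, hsub, hcard⟩ := grow ((kingComp B v).card - 1) (by omega)
  rwa [Finset.eq_of_subset_of_card_le hsub (by omega)] at hC


/-- The discrete gradient of a configuration. -/
def grad {d q : ℕ} (ω : Zd d → ZMod q) (i : Fin d) (x : Zd d) : ZMod q := ω (x + unitVec i) - ω x

/-- The gradient of a configuration, restricted to the edges with base point in `A`. -/
def gradOn {d q : ℕ} (A : Finset (Zd d)) (ω : Zd d → ZMod q) (i : Fin d) (x : Zd d) : ZMod q :=
  if x ∈ A then grad ω i x else 0

/-- The sum to infinity of a function supported in `box d N` along the half-line in direction `i₀`,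
with a minus sign. -/
def linePrim {d q : ℕ} (N : ℕ) (i₀ : Fin d) (g : Zd d → ZMod q) (x : Zd d) : ZMod q :=
  -∑ j ∈ Finset.range (N + 1 - x i₀).toNat, g (x + (j : ℤ) • unitVec i₀)

lemma add_smul_unitVec_same {d : ℕ} (x : Zd d) (i : Fin d) (t : ℤ) :
    (x + t • unitVec i) i = x i + t := by simp [unitVec_same]

lemma add_smul_unitVec_of_ne {d : ℕ} (x : Zd d) {i j : Fin d} (h : j ≠ i) (t : ℤ) :
    (x + t • unitVec i) j = x j := by simp [unitVec_of_ne h]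

lemma notMem_box {d N : ℕ} {x : Zd d} (i : Fin d) (h : (N : ℤ) < |x i|) : x ∉ box d N :=
  fun hx => absurd (mem_box.1 hx i) (not_le.2 h)

lemma linePrim_eq_sum_range {d q : ℕ} {N : ℕ} {i₀ : Fin d} {g : Zd d → ZMod q}
    (hg : ∀ x, x ∉ box d N → g x = 0) (x : Zd d) {M : ℕ} (hM : (N + 1 - x i₀).toNat ≤ M) :
    linePrim N i₀ g x = -∑ j ∈ Finset.range M, g (x + (j : ℤ) • unitVec i₀) := by
  rw [linePrim]
  congr 1
  refine Finset.sum_subset (Finset.range_mono hM) fun j _ hj => hg _ (notMem_box i₀ ?_)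
  rw [add_smul_unitVec_same]
  rw [Finset.mem_range] at hj
  exact lt_of_lt_of_le (by omega) (le_abs_self _)

/-- A discrete Poincaré lemma: a compactly supported closed cochain is the gradient of its
line integrals. -/
lemma grad_linePrim {d q : ℕ} {N : ℕ} {i₀ : Fin d} {g : Fin d → Zd d → ZMod q}
    (hg : ∀ i x, x ∉ box d N → g i x = 0)
    (hclosed : ∀ i x, g i (x + unitVec i₀) - g i x = g i₀ (x + unitVec i) - g i₀ x)
    (i : Fin d) (x : Zd d) : grad (linePrim N i₀ (g i₀)) i x = g i x := by
  set M := (N + 1 - x i₀).toNat + (N + 1 - (x + unitVec i) i₀).toNat with hM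
  rw [grad, linePrim_eq_sum_range (hg i₀) x (M := M) (by omega),
    linePrim_eq_sum_range (hg i₀) (x + unitVec i) (M := M) (by omega), ← sub_eq_zero]
  have h1 : ∑ j ∈ Finset.range M, (g i₀ (x + unitVec i + (j : ℤ) • unitVec i₀)
      - g i₀ (x + (j : ℤ) • unitVec i₀)) = g i (x + (M : ℤ) • unitVec i₀) - g i x := by
    have h2 := Finset.sum_range_sub (fun j : ℕ => g i (x + (j : ℤ) • unitVec i₀)) M
    simp only [Nat.cast_zero, zero_smul, add_zero] at h2
    rw [← h2]
    refine Finset.sum_congr rfl fun j _ => ?_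
    have h3 := hclosed i (x + (j : ℤ) • unitVec i₀)
    rw [add_right_comm, ← h3]
    congr 2
    push_cast
    rw [add_smul, one_smul, add_assoc]
  have h4 : g i (x + (M : ℤ) • unitVec i₀) = 0 := by
    refine hg i _ (notMem_box i₀ ?_)
    rw [add_smul_unitVec_same]
    exact lt_of_lt_of_le (by omega) (le_abs_self _)
  rw [Finset.sum_sub_distrib, h4] at h1
  linear_combination (-1 : ZMod q) * h1

/-- Base points of the edges along which the configuration `ω` is not constant. -/
def badSet {d q : ℕ} (N : ℕ) (ω : Zd d → ZMod q) : Finset (Zd d) :=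
  (box d (N + 1)).filter fun x => ∃ i, grad ω i x ≠ 0

lemma grad_eq_zero_of_notMem_box {d q : ℕ} {N : ℕ} {ω : Zd d → ZMod q} {k : ZMod q}
    (hω : ∀ x, x ∉ box d N → ω x = k) {x : Zd d} {i : Fin d} (hx : x ∉ box d N)
    (hx' : x + unitVec i ∉ box d N) : grad ω i x = 0 := by
  rw [grad, hω _ hx, hω _ hx', sub_self]

lemma mem_box_or_of_grad_ne_zero {d q : ℕ} {N : ℕ} {ω : Zd d → ZMod q} {k : ZMod q}
    (hω : ∀ x, x ∉ box d N → ω x = k) {x : Zd d} {i : Fin d} (h : grad ω i x ≠ 0) :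
    x ∈ box d N ∨ x + unitVec i ∈ box d N := by
  by_contra! hcon
  exact h (grad_eq_zero_of_notMem_box hω hcon.1 hcon.2)

lemma mem_badSet {d q : ℕ} {N : ℕ} {ω : Zd d → ZMod q} {k : ZMod q}
    (hω : ∀ x, x ∉ box d N → ω x = k) {x : Zd d} : x ∈ badSet N ω ↔ ∃ i, grad ω i x ≠ 0 := by
  rw [badSet, Finset.mem_filter, and_iff_right_iff_imp]
  rintro ⟨i, hi⟩
  rw [mem_box]
  intro j
  rcases mem_box_or_of_grad_ne_zero hω hi with h | h
  · have := mem_box.1 h j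
    push_cast
    omega
  · have h1 := mem_box.1 h j
    rw [Pi.add_apply] at h1
    have h2 : |unitVec i j| ≤ 1 := by
      by_cases hj : j = i
      · subst hj; simp [unitVec_same]
      · simp [unitVec_of_ne hj]
    rw [abs_le] at *
    push_cast
    omega

lemma badSet_subset_box {d q : ℕ} (N : ℕ) (ω : Zd d → ZMod q) : badSet N ω ⊆ box d (N + 1) :=
  Finset.filter_subset _ _

/-- `A` is a set of bad points of `ω` containing all bad points near it. -/
structure IsContour {d q : ℕ} (N : ℕ) (ω : Zd d → ZMod q) (A : Finset (Zd d)) : Prop where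
  subset : A ⊆ badSet N ω
  near : ∀ x ∈ A, ∀ y ∈ badSet N ω, y - x ∈ box d 1 → y ∈ A

lemma isContour_kingComp {d q : ℕ} (N : ℕ) (ω : Zd d → ZMod q) (v : Zd d) :
    IsContour N ω (kingComp (badSet N ω) v) where
  subset := fun _ hx => (mem_kingComp.1 hx).1
  near := fun _ hx _ hy hxy => mem_kingComp_of_near hx hy hxy

lemma unitVec_mem_box {d : ℕ} (i : Fin d) : unitVec i ∈ box d 1 := by
  rw [mem_box]
  intro j
  by_cases hj : j = i
  · subst hj; simp [unitVec_same]
  · simp [unitVec_of_ne hj]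

lemma unitVec_sub_unitVec_mem_box {d : ℕ} (i j : Fin d) : unitVec i - unitVec j ∈ box d 1 := by
  rw [mem_box]
  intro l
  simp only [unitVec, Pi.sub_apply, Pi.single_apply]
  split_ifs <;> simp

section Contour

variable {d q N : ℕ} {ω : Zd d → ZMod q} {k : ZMod q} {A : Finset (Zd d)}

lemma gradOn_eq_grad (hω : ∀ x, x ∉ box d N → ω x = k) {x : Zd d} (i : Fin d)
    (h : x ∈ badSet N ω → x ∈ A) : gradOn A ω i x = grad ω i x := by
  rw [gradOn]
  split_ifs with hx
  · rfl
  · by_contra hne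
    exact hx (h ((mem_badSet hω).2 ⟨i, fun h0 => hne h0.symm⟩))

lemma gradOn_closed (hω : ∀ x, x ∉ box d N → ω x = k) (hA : IsContour N ω A) (i j : Fin d)
    (x : Zd d) : gradOn A ω i (x + unitVec j) - gradOn A ω i x =
      gradOn A ω j (x + unitVec i) - gradOn A ω j x := by
  by_cases hcase : x ∈ A ∨ x + unitVec j ∈ A ∨ x + unitVec i ∈ A
  · have h0 : x ∈ badSet N ω → x ∈ A := by
      intro hb
      rcases hcase with h | h | h
      · exact h
      · exact hA.near _ h _ hb (by simpa using neg_mem_box (unitVec_mem_box j))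
      · exact hA.near _ h _ hb (by simpa using neg_mem_box (unitVec_mem_box i))
    have h1 : x + unitVec j ∈ badSet N ω → x + unitVec j ∈ A := by
      intro hb
      rcases hcase with h | h | h
      · exact hA.near _ h _ hb (by simpa using unitVec_mem_box j)
      · exact h
      · exact hA.near _ h _ hb (by simpa using unitVec_sub_unitVec_mem_box j i)
    have h2 : x + unitVec i ∈ badSet N ω → x + unitVec i ∈ A := by
      intro hb
      rcases hcase with h | h | h
      · exact hA.near _ h _ hb (by simpa using unitVec_mem_box i)
      · exact hA.near _ h _ hb (by simpa using unitVec_sub_unitVec_mem_box i j)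
      · exact h
    rw [gradOn_eq_grad hω i h1, gradOn_eq_grad hω i h0, gradOn_eq_grad hω j h2,
      gradOn_eq_grad hω j h0]
    simp only [grad]
    rw [add_right_comm x (unitVec j) (unitVec i)]
    ring
  · push Not at hcase
    simp [gradOn, hcase.1, hcase.2.1, hcase.2.2]

/-- The potential of the part of the gradient of `ω` that is carried by `A`. -/
def contourPot (N : ℕ) (i₀ : Fin d) (A : Finset (Zd d)) (ω : Zd d → ZMod q) : Zd d → ZMod q :=
  linePrim (N + 1) i₀ (gradOn A ω i₀)

lemma gradOn_eq_zero (hA : IsContour N ω A) (i : Fin d) {x : Zd d} (hx : x ∉ box d (N + 1)) :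
    gradOn A ω i x = 0 :=
  if_neg fun h => hx (badSet_subset_box N ω (hA.subset h))

lemma grad_contourPot (hω : ∀ x, x ∉ box d N → ω x = k) (hA : IsContour N ω A) (i₀ i : Fin d)
    (x : Zd d) : grad (contourPot N i₀ A ω) i x = gradOn A ω i x :=
  grad_linePrim (g := gradOn A ω) (fun i _ hx => gradOn_eq_zero hA i hx)
    (fun i x => gradOn_closed hω hA i i₀ x) i x

lemma gradOn_eq_zero_of_notMem_box (hω : ∀ x, x ∉ box d N → ω x = k) {x : Zd d} {i : Fin d}
    (hx : x ∉ box d N) (hx' : x + unitVec i ∉ box d N) : gradOn A ω i x = 0 := by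
  rw [gradOn, grad_eq_zero_of_notMem_box hω hx hx', ite_self]

lemma contourPot_eq_zero_of_line (i₀ : Fin d) (x : Zd d)
    (h : ∀ j : ℕ, gradOn A ω i₀ (x + (j : ℤ) • unitVec i₀) = 0) : contourPot N i₀ A ω x = 0 := by
  rw [contourPot, linePrim, Finset.sum_eq_zero fun j _ => h j, neg_zero]

lemma contourPot_add_smul (hω : ∀ x, x ∉ box d N → ω x = k) (hA : IsContour N ω A)
    (i₀ i : Fin d) (x : Zd d) (m : ℕ)
    (h : ∀ t : ℕ, t < m → gradOn A ω i (x + (t : ℤ) • unitVec i) = 0) :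
    contourPot N i₀ A ω (x + (m : ℤ) • unitVec i) = contourPot N i₀ A ω x := by
  induction m with
  | zero => simp
  | succ m ih =>
    rw [← ih fun t ht => h t (by omega)]
    have h1 := grad_contourPot hω hA i₀ i (x + (m : ℤ) • unitVec i)
    rw [h m (by omega), grad, sub_eq_zero] at h1
    rw [← h1]
    congr 1
    push_cast
    rw [add_smul, one_smul, add_assoc]

lemma contourPot_eq_zero_of_notMem_box (hω : ∀ x, x ∉ box d N → ω x = k)
    (hA : IsContour N ω A) {i₀ i₁ : Fin d} (hi : i₁ ≠ i₀) {x : Zd d} (hx : x ∉ box d N) :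
    contourPot N i₀ A ω x = 0 := by
  have side : ∀ j ≠ i₀, ∀ y : Zd d, (N : ℤ) < |y j| → contourPot N i₀ A ω y = 0 := by
    intro j hj y hy
    refine contourPot_eq_zero_of_line i₀ y fun t => ?_
    refine gradOn_eq_zero_of_notMem_box hω (notMem_box j ?_) (notMem_box j ?_)
    · rwa [add_smul_unitVec_of_ne _ hj]
    · rwa [Pi.add_apply, add_smul_unitVec_of_ne _ hj, unitVec_of_ne hj, add_zero]
  rw [mem_box] at hx
  push Not at hx
  obtain ⟨j, hj⟩ := hx
  by_cases hji : j = i₀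
  · subst hji
    rcases lt_abs.1 hj with h | h
    · refine contourPot_eq_zero_of_line j x fun t => ?_
      refine gradOn_eq_zero_of_notMem_box hω (notMem_box j ?_) (notMem_box j ?_)
      · rw [add_smul_unitVec_same]
        exact lt_of_lt_of_le (by omega) (le_abs_self _)
      · rw [Pi.add_apply, add_smul_unitVec_same, unitVec_same]
        exact lt_of_lt_of_le (by omega) (le_abs_self _)
    · rw [← contourPot_add_smul hω hA j i₁ x (N + 1 - x i₁).toNat]
      · refine side i₁ hi _ ?_
        rw [add_smul_unitVec_same]
        exact lt_of_lt_of_le (by omega) (le_abs_self _)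
      · intro t _
        refine gradOn_eq_zero_of_notMem_box hω (notMem_box j ?_) (notMem_box j ?_)
        · rwa [add_smul_unitVec_of_ne _ hi.symm]
        · rwa [Pi.add_apply, add_smul_unitVec_of_ne _ hi.symm, unitVec_of_ne hi.symm, add_zero]
  · exact side j hji x hj

/-- A contour with nonzero potential at `x` meets the half-line from `x` in direction `i₀` at a
distance smaller than its cardinality. -/
lemma exists_mem_of_contourPot_ne_zero (hω : ∀ x, x ∉ box d N → ω x = k)
    (hA : IsContour N ω A) {i₀ i₁ : Fin d} (hi : i₁ ≠ i₀) {x : Zd d}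
    (hx : contourPot N i₀ A ω x ≠ 0) :
    ∃ j : ℕ, j < A.card ∧ x + (j : ℤ) • unitVec i₀ ∈ A := by
  classical
  have hex : ∃ j : ℕ, x + (j : ℤ) • unitVec i₀ ∈ A := by
    by_contra! hcon
    exact hx (contourPot_eq_zero_of_line i₀ x fun j => if_neg (hcon j))
  refine ⟨Nat.find hex, ?_, Nat.find_spec hex⟩
  have hsub : (Finset.range (Nat.find hex + 1)).image (fun m : ℕ => x i₀ + (m : ℤ)) ⊆
      A.image fun a => a i₀ := by
    intro c hc
    obtain ⟨m, hm, rfl⟩ := Finset.mem_image.1 hc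
    rw [Finset.mem_range] at hm
    have hm' : contourPot N i₀ A ω (x + (m : ℤ) • unitVec i₀) ≠ 0 := by
      rw [contourPot_add_smul hω hA i₀ i₀ x m]
      · exact hx
      · exact fun t ht => if_neg (Nat.find_min hex (by omega))
    by_contra hcon
    set y := x + (m : ℤ) • unitVec i₀ with hy
    have hcol : ∀ t : ℕ, y + (t : ℤ) • unitVec i₁ ∉ A := by
      intro t ht
      refine hcon (Finset.mem_image.2 ⟨_, ht, ?_⟩)
      rw [add_smul_unitVec_of_ne _ hi.symm, hy, add_smul_unitVec_same]
    refine hm' ?_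
    rw [← contourPot_add_smul hω hA i₀ i₁ y (N + 1 - y i₁).toNat fun t _ => if_neg (hcol t)]
    refine contourPot_eq_zero_of_notMem_box hω hA hi (notMem_box i₁ ?_)
    rw [add_smul_unitVec_same]
    exact lt_of_lt_of_le (by omega) (le_abs_self _)
  have hcard := (Finset.card_le_card hsub).trans Finset.card_image_le
  rw [Finset.card_image_of_injective _ fun a b h => by simpa using h, Finset.card_range] at hcard
  omega

lemma exists_kingComp_contourPot_ne_zero (hω : ∀ x, x ∉ box d N → ω x = k) (i₀ : Fin d)
    {x : Zd d} (hx : ω x ≠ k) :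
    ∃ v ∈ badSet N ω, contourPot N i₀ (kingComp (badSet N ω) v) ω x ≠ 0 := by
  by_contra! hcon
  set B := badSet N ω with hB
  set M := (((N + 1 : ℕ) : ℤ) + 1 - x i₀).toNat with hM
  have htel : ∑ j ∈ Finset.range M, grad ω i₀ (x + (j : ℤ) • unitVec i₀) = k - ω x := by
    have h2 := Finset.sum_range_sub (fun j : ℕ => ω (x + (j : ℤ) • unitVec i₀)) M
    simp only [Nat.cast_zero, zero_smul, add_zero] at h2
    rw [hω (x + (M : ℤ) • unitVec i₀)] at h2
    · rw [← h2]
      refine Finset.sum_congr rfl fun j _ => ?_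
      rw [grad]
      congr 2
      push_cast
      rw [add_smul, one_smul, add_assoc]
    · refine notMem_box i₀ ?_
      rw [add_smul_unitVec_same]
      exact lt_of_lt_of_le (by omega) (le_abs_self _)
  have hfil : ∑ j ∈ (Finset.range M).filter (fun j : ℕ => x + (j : ℤ) • unitVec i₀ ∈ B),
      grad ω i₀ (x + (j : ℤ) • unitVec i₀) = k - ω x := by
    rw [← htel, Finset.sum_filter]
    refine Finset.sum_congr rfl fun j _ => ?_
    split_ifs with h
    · rfl
    · by_contra hne
      exact h ((mem_badSet hω).2 ⟨i₀, fun h0 => hne h0.symm⟩)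
  rw [← Finset.sum_fiberwise_of_maps_to (t := B.image (kingComp B))
    (g := fun j : ℕ => kingComp B (x + (j : ℤ) • unitVec i₀))] at hfil
  · rw [Finset.sum_eq_zero] at hfil
    · exact hx (sub_eq_zero.1 hfil.symm).symm
    · intro C hC
      obtain ⟨v, hv, rfl⟩ := Finset.mem_image.1 hC
      have hz := hcon v hv
      rw [contourPot, linePrim, neg_eq_zero] at hz
      rw [← hz, Finset.filter_filter, Finset.sum_filter]
      refine Finset.sum_congr rfl fun j _ => ?_
      rw [gradOn]
      refine if_congr ?_ rfl rfl
      constructor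
      · rintro ⟨h1, h2⟩
        rw [← h2]; exact self_mem_kingComp h1
      · intro h
        exact ⟨(mem_kingComp.1 h).1, kingComp_eq_of_mem hv h⟩
  · intro j hj
    exact Finset.mem_image_of_mem _ (Finset.mem_filter.1 hj).2

end Contour


lemma eq_unitVec_or_neg_of_l1_eq_one {d : ℕ} {z : Zd d} (hz : l1 z = 1) :
    ∃ i, z = unitVec i ∨ z = -unitVec i := by
  have hex : ∃ i, z i ≠ 0 := by
    by_contra! hcon
    simp [l1, hcon] at hz
  obtain ⟨i, hi⟩ := hex
  have h1 : l1 z = |z i| + ∑ j ∈ Finset.univ.erase i, |z j| :=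
    (Finset.add_sum_erase _ (fun j => |z j|) (Finset.mem_univ i)).symm
  have hpos : 1 ≤ |z i| := Int.one_le_abs hi
  have hnn : 0 ≤ ∑ j ∈ Finset.univ.erase i, |z j| := Finset.sum_nonneg fun _ _ => abs_nonneg _
  have h0 : ∑ j ∈ Finset.univ.erase i, |z j| = 0 := by omega
  rw [Finset.sum_eq_zero_iff_of_nonneg fun _ _ => abs_nonneg _] at h0
  have hother : ∀ j ≠ i, z j = 0 := fun j hj =>
    abs_eq_zero.1 (h0 j (Finset.mem_erase.2 ⟨hj, Finset.mem_univ j⟩))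
  have hzi : z i = 1 ∨ z i = -1 := by
    have : |z i| = 1 := by omega
    exact (abs_eq zero_le_one).1 this
  refine ⟨i, hzi.imp (fun h => ?_) fun h => ?_⟩ <;>
  · ext j
    by_cases hj : j = i
    · subst hj; simp [unitVec_same, h]
    · simp [unitVec_of_ne hj, hother j hj]

lemma mem_box_succ_of_l1_eq_one {d N : ℕ} {x y : Zd d} (hx : x ∈ box d N)
    (hxy : l1 (x - y) = 1) : y ∈ box d (N + 1) := by
  rw [mem_box] at *
  intro i
  have h1 := hx i
  have h2 := abs_apply_le_l1 (x - y) i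
  rw [hxy, Pi.sub_apply] at h2
  rw [abs_le] at *
  push_cast
  omega

lemma box_subset_succ (d N : ℕ) : box d N ⊆ box d (N + 1) := by
  intro x hx
  rw [mem_box] at *
  intro i
  have := hx i
  push_cast
  omega

section Energy

variable {d q N : ℕ} {ω ω' : Zd d → ZMod q} {k : ZMod q} {A : Finset (Zd d)}
  {h : Zd d → ZMod q → ℝ} {J : ℝ}

/-- The nearest-neighbour Hamiltonian in a box with constant boundary condition as a single sum
over ordered pairs. -/
lemma pottsHam_box (hω : ∀ x, x ∉ box d N → ω x = k) :
    pottsHam d q (JcoupNN d J) h (box d N) (fun _ => k) ω =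
      -∑ x ∈ box d N, ∑ y ∈ box d (N + 1), (if y ∈ box d N then 1 / 2 else 1) *
        (JcoupNN d J x y * (if ω x = ω y then 1 else 0)) - ∑ x ∈ box d N, h x (ω x) := by
  rw [pottsHam]
  congr 1
  rw [neg_mul, Finset.mul_sum, ← neg_add', ← Finset.sum_add_distrib]
  congr 1
  refine Finset.sum_congr rfl fun x hx => ?_
  rw [tsum_eq_sum (s := box d (N + 1)), Finset.mul_sum]
  · rw [← Finset.inter_eq_right.2 (box_subset_succ d N), ← Finset.filter_mem_eq_inter,
      Finset.sum_filter, ← Finset.sum_add_distrib]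
    refine Finset.sum_congr rfl fun y hy => ?_
    simp only [Finset.mem_filter, hy, true_and]
    by_cases hyN : y ∈ box d N
    · simp [hyN]
    · simp [hyN, hω y hyN]
  · intro y hy
    have hJ : JcoupNN d J x y = 0 := if_neg fun h1 => hy (mem_box_succ_of_l1_eq_one hx h1)
    simp [hJ]

lemma eq_of_grad_eq_zero {i : Fin d} {x : Zd d} (h : grad ω i x = 0) :
    ω (x + unitVec i) = ω x := sub_eq_zero.1 h

/-- If `ω'` is obtained from `ω` by removing all disagreements based at points of `A`, then the
interaction energy decreases by at least `J / 2 * |A|`. -/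
lemma interaction_gain (i₀ : Fin d) (hJ : 0 < J) (hω : ∀ x, x ∉ box d N → ω x = k)
    (hA : A ⊆ badSet N ω) (hgrad : ∀ i x, grad ω' i x = grad ω i x - gradOn A ω i x) :
    (∑ x ∈ box d N, ∑ y ∈ box d (N + 1), (if y ∈ box d N then 1 / 2 else 1) *
        (JcoupNN d J x y * (if ω x = ω y then (1 : ℝ) else 0))) + J / 2 * A.card ≤
      ∑ x ∈ box d N, ∑ y ∈ box d (N + 1), (if y ∈ box d N then 1 / 2 else 1) *
        (JcoupNN d J x y * (if ω' x = ω' y then (1 : ℝ) else 0)) := by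
  classical
  have hout : ∀ i x, x ∉ A → grad ω' i x = grad ω i x := fun i x hx => by
    rw [hgrad, gradOn, if_neg hx, sub_zero]
  have hin : ∀ i x, x ∈ A → grad ω' i x = 0 := fun i x hx => by
    rw [hgrad, gradOn, if_pos hx, sub_self]
  have hmono1 : ∀ i x, ω (x + unitVec i) = ω x → ω' (x + unitVec i) = ω' x := by
    intro i x hx
    refine eq_of_grad_eq_zero ?_
    by_cases hxA : x ∈ A
    · exact hin i x hxA
    · rw [hout i x hxA, grad, hx, sub_self]
  have hmono : ∀ x y, l1 (x - y) = 1 → ω x = ω y → ω' x = ω' y := by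
    intro x y hxy he
    obtain ⟨i, hi | hi⟩ := eq_unitVec_or_neg_of_l1_eq_one hxy
    · obtain rfl : x = y + unitVec i := by rw [← hi]; abel
      exact hmono1 i y he
    · obtain rfl : y = x + unitVec i := by
        rw [← neg_eq_iff_eq_neg] at hi; rw [← hi]; abel
      exact (hmono1 i x he.symm).symm
  set gain : Zd d × Zd d → ℝ := fun p => (if p.2 ∈ box d N then 1 / 2 else 1) *
    (JcoupNN d J p.1 p.2 * (if ω' p.1 = ω' p.2 then (1 : ℝ) else 0)) -
    (if p.2 ∈ box d N then 1 / 2 else 1) *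
    (JcoupNN d J p.1 p.2 * (if ω p.1 = ω p.2 then (1 : ℝ) else 0)) with hgain
  have hgain_nonneg : ∀ p, 0 ≤ gain p := by
    rintro ⟨x, y⟩
    simp only [hgain]
    rw [← mul_sub, ← mul_sub]
    by_cases hxy : l1 (x - y) = 1
    · have := hmono x y hxy
      have hc : (0 : ℝ) ≤ (if y ∈ box d N then 1 / 2 else 1) := by split_ifs <;> norm_num
      have hJ' : 0 ≤ JcoupNN d J x y := by rw [JcoupNN, if_pos hxy]; exact hJ.le
      have : (0 : ℝ) ≤ (if ω' x = ω' y then 1 else 0) - (if ω x = ω y then 1 else 0) := by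
        split_ifs <;> simp_all
      positivity
    · simp [JcoupNN, hxy]
  have hgain_pair : ∀ x y, l1 (x - y) = 1 → ω x ≠ ω y → ω' x = ω' y → J / 2 ≤ gain (x, y) := by
    intro x y hxy h1 h2
    simp only [hgain, JcoupNN, if_pos hxy, if_neg h1, if_pos h2]
    split_ifs <;> linarith
  have : Nonempty (Fin d) := ⟨i₀⟩
  have hdir : ∀ a ∈ A, ∃ i, grad ω i a ≠ 0 := fun a ha => (mem_badSet hω).1 (hA ha)
  choose! f hf using hdir
  set pair : Zd d → Zd d × Zd d := fun a =>
    if a ∈ box d N then (a, a + unitVec (f a)) else (a + unitVec (f a), a) with hpair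
  have hsymm : ∀ a : Zd d, ∀ i, l1 (a - (a + unitVec i)) = 1 := by
    intro a i
    rw [sub_add_cancel_left]
    simpa [l1] using l1_unitVec i
  have hsymm' : ∀ a : Zd d, ∀ i, l1 (a + unitVec i - a) = 1 := by
    intro a i
    rw [add_sub_cancel_left, l1_unitVec]
  have hmem : ∀ a ∈ A, pair a ∈ box d N ×ˢ box d (N + 1) := by
    intro a ha
    simp only [hpair]
    split_ifs with hbox
    · exact Finset.mem_product.2 ⟨hbox, mem_box_succ_of_l1_eq_one hbox (hsymm a _)⟩
    · exact Finset.mem_product.2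
        ⟨(mem_box_or_of_grad_ne_zero hω (hf a ha)).resolve_left hbox,
          badSet_subset_box N ω (hA ha)⟩
  have hinj : Set.InjOn pair A := by
    intro a _ b _ hab
    have hsum : ∀ i j : Fin d, unitVec i + unitVec j ≠ 0 := by
      intro i j h0
      have h1 := congrFun h0 i
      by_cases hij : i = j
      · subst hij; simp [unitVec_same] at h1
      · simp [unitVec_same, unitVec_of_ne hij] at h1
    simp only [hpair] at hab
    split_ifs at hab with h1 h2 h2
    · exact (Prod.ext_iff.1 hab).1
    · obtain ⟨e1, e2⟩ := Prod.ext_iff.1 hab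
      simp only at e1 e2
      rw [e1, add_assoc] at e2
      exact absurd (add_eq_left.1 e2) (hsum _ _)
    · obtain ⟨e1, e2⟩ := Prod.ext_iff.1 hab
      simp only at e1 e2
      rw [e2, add_assoc] at e1
      exact absurd (add_eq_left.1 e1) (hsum _ _)
    · exact (Prod.ext_iff.1 hab).2
  have hpair_gain : ∀ a ∈ A, J / 2 ≤ gain (pair a) := by
    intro a ha
    have hne : ω (a + unitVec (f a)) ≠ ω a := fun he => hf a ha (sub_eq_zero.2 he)
    have heq := eq_of_grad_eq_zero (hin (f a) a ha)
    simp only [hpair]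
    split_ifs
    · exact hgain_pair _ _ (hsymm a _) hne.symm heq.symm
    · exact hgain_pair _ _ (hsymm' a _) hne heq
  have htotal : J / 2 * A.card ≤ ∑ p ∈ box d N ×ˢ box d (N + 1), gain p := by
    calc J / 2 * A.card = ∑ _a ∈ A, J / 2 := by simp [mul_comm]
      _ ≤ ∑ a ∈ A, gain (pair a) := Finset.sum_le_sum hpair_gain
      _ = ∑ p ∈ A.image pair, gain p := (Finset.sum_image hinj).symm
      _ ≤ _ := Finset.sum_le_sum_of_subset_of_nonneg
          (Finset.image_subset_iff.2 hmem) fun p _ _ => hgain_nonneg p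
  rw [Finset.sum_product] at htotal
  simp only [hgain, Finset.sum_sub_distrib] at htotal
  linarith

/-- Removing a contour `A` decreases the energy by at least `J / 4 * |A|`. -/
lemma pottsHam_sub_contourPot_le (hd : 2 ≤ d) (hJ : 0 < J) (hω : ∀ x, x ∉ box d N → ω x = k)
    (hA : IsContour N ω A) (hh : ∀ x n, 0 ≤ h x n)
    (hdecay : ∀ x n, h x n ≤ J / (4 * d) * (1 / ((l1 x : ℝ) + 1))) {i₀ i₁ : Fin d}
    (hi : i₁ ≠ i₀) :
    pottsHam d q (JcoupNN d J) h (box d N) (fun _ => k) (ω - contourPot N i₀ A ω) +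
        J / 4 * A.card ≤
      pottsHam d q (JcoupNN d J) h (box d N) (fun _ => k) ω := by
  set τ := contourPot N i₀ A ω with hτ
  have hτ0 : ∀ x, x ∉ box d N → τ x = 0 :=
    fun x hx => contourPot_eq_zero_of_notMem_box hω hA hi hx
  have hω' : ∀ x, x ∉ box d N → (ω - τ) x = k := fun x hx => by
    rw [Pi.sub_apply, hω x hx, hτ0 x hx, sub_zero]
  have hgrad : ∀ i x, grad (ω - τ) i x = grad ω i x - gradOn A ω i x := by
    intro i x
    rw [← grad_contourPot hω hA i₀ i x]
    simp only [grad, Pi.sub_apply, ← hτ]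
    ring
  rw [pottsHam_box hω, pottsHam_box hω']
  have hint := interaction_gain i₀ hJ hω hA.subset hgrad
  have hfield : ∑ x ∈ box d N, h x (ω x) ≤
      ∑ x ∈ box d N, h x ((ω - τ) x) + J / 4 * A.card := by
    set I := (box d N).filter fun x => τ x ≠ 0 with hI
    have memI : ∀ x, x ∈ I ↔ τ x ≠ 0 := by
      intro x
      rw [hI, Finset.mem_filter, and_iff_right_iff_imp]
      intro hx
      by_contra hb
      exact hx (hτ0 x hb)
    have hiso : ∑ x ∈ I, 1 / ((l1 x : ℝ) + 1) ≤ d * (A.card : ℝ) := by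
      refine sum_one_div_l1_le hd I A fun x i hx => ?_
      have h1 := grad_contourPot hω hA i₀ i x
      rw [gradOn, if_neg hx] at h1
      rw [memI, memI, hτ, eq_of_grad_eq_zero h1]
    have hd0 : (0 : ℝ) < d := by exact_mod_cast (by omega : 0 < d)
    calc ∑ x ∈ box d N, h x (ω x)
        ≤ ∑ x ∈ box d N, (h x ((ω - τ) x) +
            if τ x ≠ 0 then J / (4 * d) * (1 / ((l1 x : ℝ) + 1)) else 0) := by
          refine Finset.sum_le_sum fun x _ => ?_
          split_ifs with hx
          · linarith [hdecay x (ω x), hh x ((ω - τ) x)]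
          · rw [not_not] at hx
            simp [hx]
      _ = ∑ x ∈ box d N, h x ((ω - τ) x) +
            J / (4 * d) * ∑ x ∈ I, 1 / ((l1 x : ℝ) + 1) := by
          rw [Finset.sum_add_distrib, Finset.mul_sum, hI, ← Finset.sum_filter]
      _ ≤ ∑ x ∈ box d N, h x ((ω - τ) x) + J / (4 * d) * (d * A.card) := by gcongr
      _ = _ := by field_simp
  linarith

end Energy


/-- A weighted union bound. -/
lemma sum_le_sum_sum_of_cover {ι α : Type*} [DecidableEq α] (T : Finset ι) (S : Finset α)
    (E : ι → Finset α) (w : α → ℝ) (hw : ∀ a, 0 ≤ w a) (hS : ∀ a ∈ S, ∃ i ∈ T, a ∈ E i) :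
    ∑ a ∈ S, w a ≤ ∑ i ∈ T, ∑ a ∈ E i, w a := by
  classical
  rcases S.eq_empty_or_nonempty with rfl | ⟨a₀, ha₀⟩
  · simpa using Finset.sum_nonneg fun i _ => Finset.sum_nonneg fun a _ => hw a
  have : Nonempty ι := ⟨(hS a₀ ha₀).choose⟩
  choose! f hfT hfE using hS
  calc ∑ a ∈ S, w a = ∑ i ∈ T, ∑ a ∈ S with f a = i, w a :=
        (Finset.sum_fiberwise_of_maps_to hfT _).symm
    _ ≤ _ := Finset.sum_le_sum fun i _ => Finset.sum_le_sum_of_subset_of_nonneg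
        (fun a ha => by
          obtain ⟨h1, h2⟩ := Finset.mem_filter.1 ha
          exact h2 ▸ hfE a h1) fun a _ _ => hw a

lemma sum_range_pow_succ_le {r : ℝ} (h0 : 0 ≤ r) (hr : r ≤ 1 / 4) (M : ℕ) :
    ∑ n ∈ Finset.range M, r ^ (n + 1) ≤ 1 / 3 := by
  have h : ∀ M : ℕ, ∑ n ∈ Finset.range M, (1 / 4 : ℝ) ^ (n + 1) = 1 / 3 * (1 - (1 / 4) ^ M) := by
    intro M
    induction M with
    | zero => simp
    | succ M ih => rw [Finset.sum_range_succ, ih]; ring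
  calc ∑ n ∈ Finset.range M, r ^ (n + 1) ≤ ∑ n ∈ Finset.range M, (1 / 4 : ℝ) ^ (n + 1) := by
        gcongr
    _ ≤ 1 / 3 := by
        rw [h]
        have : (0 : ℝ) ≤ (1 / 4) ^ M := by positivity
        linarith

lemma extendCfg_of_notMem {d q : ℕ} {Λ : Finset (Zd d)} {η : Zd d → ZMod q} {σ : Λ → ZMod q}
    {x : Zd d} (hx : x ∉ Λ) : extendCfg Λ η σ x = η x := by simp [extendCfg, hx]

section Peierls

variable {d q N : ℕ} {k : ZMod q} {h : Zd d → ZMod q → ℝ} {J β : ℝ}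

/-- The unnormalised Gibbs weight in a box with constant boundary condition. -/
def boxWeight (d q : ℕ) (J β : ℝ) (h : Zd d → ZMod q → ℝ) (N : ℕ) (k : ZMod q)
    (σ : box d N → ZMod q) : ℝ :=
  Real.exp (-(β * pottsHam d q (JcoupNN d J) h (box d N) (fun _ => k)
    (extendCfg (box d N) (fun _ => k) σ)))

lemma boxWeight_pos (σ : box d N → ZMod q) : 0 < boxWeight d q J β h N k σ := Real.exp_pos _

open Classical in
/-- The weight of the configurations having a given contour. -/
lemma sum_boxWeight_contour_le [NeZero q] (hd : 2 ≤ d) (hJ : 0 < J) (hβ : 0 ≤ β) (hh : ∀ x n, 0 ≤ h x n)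
    (hdecay : ∀ x n, h x n ≤ J / (4 * d) * (1 / ((l1 x : ℝ) + 1))) {i₀ i₁ : Fin d}
    (hi : i₁ ≠ i₀) (A : Finset (Zd d)) :
    ∑ σ : box d N → ZMod q with IsContour N (extendCfg (box d N) (fun _ => k) σ) A,
        boxWeight d q J β h N k σ ≤
      ((q : ℝ) ^ d * Real.exp (-(β * (J / 4)))) ^ A.card *
        ∑ σ : box d N → ZMod q, boxWeight d q J β h N k σ := by
  set ext : (box d N → ZMod q) → Zd d → ZMod q := extendCfg (box d N) (fun _ => k) with hext
  have hω : ∀ σ x, x ∉ box d N → ext σ x = k := fun σ x hx => extendCfg_of_notMem hx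
  set E := Finset.univ.filter fun σ : box d N → ZMod q => IsContour N (ext σ) A with hE
  set T : (box d N → ZMod q) → box d N → ZMod q :=
    fun σ x => σ x - contourPot N i₀ A (ext σ) x with hT
  have hextT : ∀ σ ∈ E, ext (T σ) = ext σ - contourPot N i₀ A (ext σ) := by
    intro σ hσ
    have hA : IsContour N (ext σ) A := (Finset.mem_filter.1 hσ).2
    ext x
    by_cases hx : x ∈ box d N
    · rw [Pi.sub_apply]
      simp [hext, extendCfg, hx, hT]
    · rw [hω _ x hx, Pi.sub_apply, hω _ x hx,
        contourPot_eq_zero_of_notMem_box (hω σ) hA hi hx, sub_zero]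
  have hweight : ∀ σ ∈ E, boxWeight d q J β h N k σ ≤
      Real.exp (-(β * (J / 4))) ^ A.card * boxWeight d q J β h N k (T σ) := by
    intro σ hσ
    have hA : IsContour N (ext σ) A := (Finset.mem_filter.1 hσ).2
    have hen := pottsHam_sub_contourPot_le hd hJ (hω σ) hA hh hdecay hi
    rw [boxWeight, boxWeight, ← Real.exp_nat_mul, ← Real.exp_add, ← hext, hextT σ hσ]
    refine Real.exp_le_exp.2 ?_
    have := mul_le_mul_of_nonneg_left hen hβ
    linarith
  set label : (box d N → ZMod q) → A → Fin d → ZMod q :=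
    fun σ a i => grad (ext σ) i a with hlabel
  have hinj : Set.InjOn (fun σ => (T σ, label σ)) E := by
    intro σ hσ σ' hσ' heq
    obtain ⟨h1, h2⟩ := Prod.ext_iff.1 heq
    simp only at h1 h2
    have hgrad : gradOn A (ext σ) i₀ = gradOn A (ext σ') i₀ := by
      ext x
      rw [gradOn, gradOn]
      split_ifs with hx
      · exact congrFun (congrFun h2 ⟨x, hx⟩) i₀
      · rfl
    have hpot : contourPot N i₀ A (ext σ) = contourPot N i₀ A (ext σ') := by
      rw [contourPot, contourPot, hgrad]
    ext x
    have h3 := congrFun h1 x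
    simp only [hT, hpot] at h3
    exact sub_left_injective h3
  calc ∑ σ ∈ E, boxWeight d q J β h N k σ
      ≤ ∑ σ ∈ E, Real.exp (-(β * (J / 4))) ^ A.card * boxWeight d q J β h N k (T σ) :=
        Finset.sum_le_sum hweight
    _ = Real.exp (-(β * (J / 4))) ^ A.card * ∑ p ∈ E.image fun σ => (T σ, label σ),
          boxWeight d q J β h N k p.1 := by
        rw [Finset.sum_image hinj, Finset.mul_sum]
    _ ≤ Real.exp (-(β * (J / 4))) ^ A.card *
          ∑ p : (box d N → ZMod q) × (A → Fin d → ZMod q), boxWeight d q J β h N k p.1 := by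
        gcongr
        · exact fun p _ _ => (boxWeight_pos _).le
        · exact Finset.subset_univ _
    _ = _ := by
        rw [Fintype.sum_prod_type]
        simp only [Finset.sum_const, Finset.card_univ, Fintype.card_fun, Fintype.card_fin,
          Fintype.card_coe, ZMod.card, nsmul_eq_mul, ← Finset.mul_sum]
        push_cast
        rw [mul_pow]
        ring

open Classical in
/-- The Peierls bound: the origin disagrees with the boundary condition with probability at
most `1 / 3`. -/
lemma peierls_bound [NeZero q] (hd : 2 ≤ d) (hJ : 0 < J) (hβ : 0 ≤ β) (hh : ∀ x n, 0 ≤ h x n)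
    (hdecay : ∀ x n, h x n ≤ J / (4 * d) * (1 / ((l1 x : ℝ) + 1)))
    (hr : 2 * 9 ^ d * (q : ℝ) ^ d * Real.exp (-(β * (J / 4))) ≤ 1 / 4) :
    ∑ σ : box d N → ZMod q with extendCfg (box d N) (fun _ => k) σ 0 ≠ k,
        boxWeight d q J β h N k σ ≤
      1 / 3 * ∑ σ : box d N → ZMod q, boxWeight d q J β h N k σ := by
  set i₀ : Fin d := ⟨0, by omega⟩
  set i₁ : Fin d := ⟨1, by omega⟩
  have hi : i₁ ≠ i₀ := by simp [i₀, i₁]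
  set Z := ∑ σ : box d N → ZMod q, boxWeight d q J β h N k σ with hZ
  have hZ0 : 0 ≤ Z := Finset.sum_nonneg fun _ _ => (boxWeight_pos _).le
  set t := (q : ℝ) ^ d * Real.exp (-(β * (J / 4))) with ht
  have ht0 : 0 ≤ t := by positivity
  set ext : (box d N → ZMod q) → Zd d → ZMod q := extendCfg (box d N) (fun _ => k) with hext
  have hω : ∀ σ x, x ∉ box d N → ext σ x = k := fun σ x hx => extendCfg_of_notMem hx
  set cont : ℕ → Finset (Finset (Zd d)) := fun n =>
    (Finset.range (n + 1)).biUnion fun j =>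
      (walkRanges d (2 * n) ((j : ℤ) • unitVec i₀)).filter fun A => A.card = n + 1 with hcont
  have hcard : ∀ n, ((cont n).card : ℝ) ≤ 2 ^ n * (9 ^ d) ^ n := by
    intro n
    have h1 : (cont n).card ≤ (n + 1) * (3 ^ d) ^ (2 * n) := by
      refine Finset.card_biUnion_le.trans ?_
      refine (Finset.sum_le_card_nsmul _ _ ((3 ^ d) ^ (2 * n)) fun j _ => ?_).trans (by simp)
      exact (Finset.card_filter_le _ _).trans (card_walkRanges_le _ _ _)
    have h2 : (n + 1) * (3 ^ d) ^ (2 * n) ≤ 2 ^ n * (9 ^ d) ^ n := by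
      have h3 : (3 ^ d) ^ (2 * n) = (9 ^ d) ^ n := by
        rw [pow_mul, ← pow_mul 3 d 2, mul_comm d 2, pow_mul]; norm_num
      rw [h3]
      exact Nat.mul_le_mul_right _ n.lt_two_pow_self
    exact_mod_cast h1.trans h2
  set M := (box d (N + 1)).card
  have hcover : ∀ σ ∈ Finset.univ.filter (fun σ : box d N → ZMod q => ext σ 0 ≠ k),
      ∃ p ∈ (Finset.range M).sigma cont,
        σ ∈ Finset.univ.filter fun σ : box d N → ZMod q => IsContour N (ext σ) p.2 := by
    intro σ hσ
    obtain ⟨v, hv, hne⟩ :=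
      exists_kingComp_contourPot_ne_zero (hω σ) i₀ (Finset.mem_filter.1 hσ).2
    set A := kingComp (badSet N (ext σ)) v
    have hA : IsContour N (ext σ) A := isContour_kingComp N (ext σ) v
    obtain ⟨j, hj, hjA⟩ := exists_mem_of_contourPot_ne_zero (hω σ) hA hi hne
    rw [zero_add] at hjA
    have hAM : A.card ≤ M :=
      Finset.card_le_card (hA.subset.trans (badSet_subset_box N (ext σ)))
    have hwalk := kingComp_mem_walkRanges (hA.subset hjA)
    rw [kingComp_eq_of_mem hv hjA] at hwalk
    refine ⟨⟨A.card - 1, A⟩, ?_, by simpa using hA⟩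
    rw [Finset.mem_sigma, Finset.mem_range]
    refine ⟨by simp only; omega, Finset.mem_biUnion.2 ⟨j, ?_, ?_⟩⟩
    · simp only [Finset.mem_range]; omega
    · exact Finset.mem_filter.2 ⟨hwalk, by simp only; omega⟩
  calc _ ≤ ∑ p ∈ (Finset.range M).sigma cont,
          ∑ σ : box d N → ZMod q with IsContour N (ext σ) p.2, boxWeight d q J β h N k σ :=
        sum_le_sum_sum_of_cover _ _ _ _ (fun _ => (boxWeight_pos _).le) hcover
    _ ≤ ∑ p ∈ (Finset.range M).sigma cont, t ^ p.2.card * Z :=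
        Finset.sum_le_sum fun p _ => sum_boxWeight_contour_le hd hJ hβ hh hdecay hi p.2
    _ = ∑ n ∈ Finset.range M, ∑ A ∈ cont n, t ^ A.card * Z := Finset.sum_sigma _ _ _
    _ ≤ ∑ n ∈ Finset.range M, (2 * 9 ^ d * t) ^ (n + 1) * Z := by
        refine Finset.sum_le_sum fun n _ => ?_
        have hc : ∀ A ∈ cont n, t ^ A.card * Z = t ^ (n + 1) * Z := by
          intro A hA
          obtain ⟨j, -, hA⟩ := Finset.mem_biUnion.1 hA
          rw [(Finset.mem_filter.1 hA).2]
        rw [Finset.sum_congr rfl hc, Finset.sum_const, nsmul_eq_mul, ← mul_assoc]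
        refine mul_le_mul_of_nonneg_right ?_ hZ0
        rw [mul_pow (2 * 9 ^ d) t]
        refine mul_le_mul_of_nonneg_right ((hcard n).trans ?_) (by positivity)
        rw [← mul_pow]
        refine pow_le_pow_right₀ ?_ (by omega)
        have : (1 : ℝ) ≤ 9 ^ d := one_le_pow₀ (by norm_num)
        linarith
    _ = (∑ n ∈ Finset.range M, (2 * 9 ^ d * t) ^ (n + 1)) * Z := by rw [Finset.sum_mul]
    _ ≤ 1 / 3 * Z := by
        gcongr
        refine sum_range_pow_succ_le (by positivity) ?_ M
        rw [ht, ← mul_assoc]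
        exact hr

end Peierls


lemma integral_pottsGibbsPM {d q : ℕ} [NeZero q] (Jc : Zd d → Zd d → ℝ) (β : ℝ)
    (h : Zd d → ZMod q → ℝ) (Λ : Finset (Zd d)) (η : Zd d → ZMod q) (G : (Zd d → ZMod q) → ℝ) :
    ∫ ω, G ω ∂(pottsGibbsPM d q Jc β h Λ η : Measure (Zd d → ZMod q)) =
      ∑ σ : Λ → ZMod q, pottsWeight d q Jc β h Λ η σ * G (extendCfg Λ η σ) := by
  have hw : ∀ σ, 0 ≤ pottsWeight d q Jc β h Λ η σ := fun σ => by unfold pottsWeight; positivity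
  change ∫ ω, G ω ∂(∑ σ : Λ → ZMod q, (ENNReal.ofReal (pottsWeight d q Jc β h Λ η σ)) •
      Measure.dirac (extendCfg Λ η σ)) = _
  rw [integral_finsetSum_measure]
  · refine Finset.sum_congr rfl fun σ _ => ?_
    rw [integral_smul_measure, integral_dirac, ENNReal.toReal_ofReal (hw σ), smul_eq_mul]
  · intro σ _
    exact (integrable_dirac (by simp)).smul_measure ENNReal.ofReal_ne_top

/-- The density cancelling the external field on the finite set `S`. -/
def fieldTilt {d q : ℕ} (β : ℝ) (h : Zd d → ZMod q → ℝ) (S : Finset (Zd d))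
    (ω : Zd d → ZMod q) : ℝ :=
  Real.exp (-(β * ∑ x ∈ S, h x (ω x)))

lemma fieldTilt_pos {d q : ℕ} (β : ℝ) (h : Zd d → ZMod q → ℝ) (S : Finset (Zd d))
    (ω : Zd d → ZMod q) : 0 < fieldTilt β h S ω := Real.exp_pos _

lemma continuous_fieldTilt {d q : ℕ} (β : ℝ) (h : Zd d → ZMod q → ℝ) (S : Finset (Zd d)) :
    Continuous (fieldTilt (q := q) β h S) := by
  unfold fieldTilt
  refine Real.continuous_exp.comp (continuous_const.mul ?_).neg
  exact continuous_finsetSum _ fun x _ =>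
    (continuous_of_discreteTopology (f := h x)).comp (continuous_apply x)

/-- The indicator of the event that the spin at the origin differs from `k`. -/
def originNe {d q : ℕ} (k : ZMod q) (ω : Zd d → ZMod q) : ℝ := if ω 0 = k then 0 else 1

lemma continuous_originNe {d q : ℕ} (k : ZMod q) : Continuous (originNe (d := d) k) :=
  (continuous_of_discreteTopology (f := fun n : ZMod q => if n = k then (0 : ℝ) else 1)).comp
    (continuous_apply (0 : Zd d))

open Classical in
/-- The external field `h` switched off on `S`. -/
def eraseField {d q : ℕ} (h : Zd d → ZMod q → ℝ) (S : Finset (Zd d)) (x : Zd d) (n : ZMod q) : ℝ :=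
  if x ∈ S then 0 else h x n

lemma pottsHam_eraseField {d q : ℕ} (Jc : Zd d → Zd d → ℝ) (h : Zd d → ZMod q → ℝ)
    {S Λ : Finset (Zd d)} (hS : S ⊆ Λ) (η σ : Zd d → ZMod q) :
    pottsHam d q Jc (eraseField h S) Λ η σ = pottsHam d q Jc h Λ η σ + ∑ x ∈ S, h x (σ x) := by
  classical
  have h1 : ∑ x ∈ Λ, eraseField h S x (σ x) + ∑ x ∈ S, h x (σ x) = ∑ x ∈ Λ, h x (σ x) := by
    rw [← Finset.sum_sdiff hS, ← Finset.sum_sdiff (f := fun x => h x (σ x)) hS]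
    have h2 : ∑ x ∈ S, eraseField h S x (σ x) = 0 :=
      Finset.sum_eq_zero fun x hx => if_pos hx
    have h3 : ∑ x ∈ Λ \ S, eraseField h S x (σ x) = ∑ x ∈ Λ \ S, h x (σ x) :=
      Finset.sum_congr rfl fun x hx => if_neg (Finset.mem_sdiff.1 hx).2
    rw [h2, h3, add_zero]
  rw [pottsHam, pottsHam, ← h1]
  ring

section Limit

variable {d q : ℕ} [NeZero q] {h : Zd d → ZMod q → ℝ} {J β : ℝ} {S : Finset (Zd d)}

lemma integral_tilt_originNe_le (hd : 2 ≤ d) (hJ : 0 < J) (hβ : 0 ≤ β) (hh : ∀ x n, 0 ≤ h x n)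
    (hdecay : ∀ x ∉ S, ∀ n, h x n ≤ J / (4 * d) * (1 / ((l1 x : ℝ) + 1)))
    (hr : 2 * 9 ^ d * (q : ℝ) ^ d * Real.exp (-(β * (J / 4))) ≤ 1 / 4) (k : ZMod q) {N : ℕ}
    (hS : S ⊆ box d N) :
    ∫ ω, fieldTilt β h S ω * originNe k ω
        ∂(pottsGibbsPM d q (JcoupNN d J) β h (box d N) (fun _ => k) : Measure (Zd d → ZMod q)) ≤
      1 / 3 * ∫ ω, fieldTilt β h S ω
        ∂(pottsGibbsPM d q (JcoupNN d J) β h (box d N) (fun _ => k) : Measure (Zd d → ZMod q)) := by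
  classical
  have hl : ∀ x : Zd d, (0 : ℝ) ≤ l1 x := fun x => by exact_mod_cast l1_nonneg x
  have hp := peierls_bound (N := N) (k := k) (h := eraseField h S) hd hJ hβ
    (fun x n => by
      rw [eraseField]; split_ifs
      · exact le_rfl
      · exact hh x n)
    (fun x n => by
      rw [eraseField]; split_ifs with hx
      · have := hl x
        positivity
      · exact hdecay x hx n) hr
  set Z := ∑ ω : box d N → ZMod q, Real.exp (-(β * pottsHam d q (JcoupNN d J) h (box d N)
    (fun _ => k) (extendCfg (box d N) (fun _ => k) ω))) with hZ
  have hZ0 : 0 ≤ Z := Finset.sum_nonneg fun _ _ => (Real.exp_pos _).le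
  have hw : ∀ σ, pottsWeight d q (JcoupNN d J) β h (box d N) (fun _ => k) σ *
      fieldTilt β h S (extendCfg (box d N) (fun _ => k) σ) =
      boxWeight d q J β (eraseField h S) N k σ / Z := by
    intro σ
    rw [boxWeight, pottsHam_eraseField _ _ hS, mul_add, neg_add, Real.exp_add, pottsWeight,
      fieldTilt]
    ring
  rw [integral_pottsGibbsPM, integral_pottsGibbsPM]
  simp only [← mul_assoc, hw]
  rw [← Finset.sum_div, Finset.sum_filter] at *
  have h1 : ∑ σ : box d N → ZMod q, boxWeight d q J β (eraseField h S) N k σ / Z *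
      originNe k (extendCfg (box d N) (fun _ => k) σ) =
      (∑ σ : box d N → ZMod q, if extendCfg (box d N) (fun _ => k) σ 0 ≠ k then
        boxWeight d q J β (eraseField h S) N k σ else 0) / Z := by
    rw [Finset.sum_div]
    refine Finset.sum_congr rfl fun σ _ => ?_
    rw [originNe]
    split_ifs <;> simp_all
  rw [h1, ← mul_div_assoc]
  gcongr

lemma tendsto_box (d : ℕ) : Tendsto (box d) atTop atTop := by
  refine tendsto_atTop_finset_of_monotone ?_ fun x => ⟨(l1 x).toNat, mem_box.2 fun i => ?_⟩
  · intro M N hMN x hx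
    rw [mem_box] at *
    intro i
    exact (hx i).trans (by exact_mod_cast hMN)
  · rw [Int.toNat_of_nonneg (l1_nonneg x)]
    exact abs_apply_le_l1 x i

lemma exists_gibbs_integral_tilt_le (hd : 2 ≤ d) (hJ : 0 < J) (hβ : 0 ≤ β)
    (hh : ∀ x n, 0 ≤ h x n)
    (hdecay : ∀ x ∉ S, ∀ n, h x n ≤ J / (4 * d) * (1 / ((l1 x : ℝ) + 1)))
    (hr : 2 * 9 ^ d * (q : ℝ) ^ d * Real.exp (-(β * (J / 4))) ≤ 1 / 4) (k : ZMod q) :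
    ∃ μ ∈ gibbsClusterSet d q (JcoupNN d J) β h,
      ∫ ω, fieldTilt β h S ω * originNe k ω ∂(μ : Measure (Zd d → ZMod q)) ≤
        1 / 3 * ∫ ω, fieldTilt β h S ω ∂(μ : Measure (Zd d → ZMod q)) := by
  set u : ℕ → ProbabilityMeasure (Zd d → ZMod q) := fun N =>
    pottsGibbsPM d q (JcoupNN d J) β h (box d N) (fun _ => k) with hu
  set U : Ultrafilter ℕ := Ultrafilter.of atTop
  have hU : (U : Filter ℕ) ≤ atTop := Ultrafilter.of_le _
  obtain ⟨μ, -, hμ⟩ := isCompact_univ.ultrafilter_le_nhds (U.map u) (by simp)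
  have hlim : Tendsto u U (nhds μ) := hμ
  refine ⟨μ, ⟨fun _ => k, ?_⟩, ?_⟩
  · have hcl : MapClusterPt μ (U : Filter ℕ) u := hlim.mapClusterPt
    exact MapClusterPt.of_comp ((tendsto_box d).mono_left hU)
      (u := fun Λ => pottsGibbsPM d q (JcoupNN d J) β h Λ fun _ => k) hcl
  · have hconv := ProbabilityMeasure.tendsto_iff_forall_integral_tendsto.1 hlim
    have c1 := hconv (BoundedContinuousFunction.mkOfCompact
      ⟨_, (continuous_fieldTilt (q := q) β h S).mul (continuous_originNe k)⟩)
    have c2 := hconv (BoundedContinuousFunction.mkOfCompact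
      ⟨_, continuous_fieldTilt (q := q) β h S⟩)
    refine le_of_tendsto_of_tendsto c1 (c2.const_mul (1 / 3)) (hU ?_)
    filter_upwards [(tendsto_box d).eventually (eventually_ge_atTop S)] with N hN
    exact integral_tilt_originNe_le hd hJ hβ hh hdecay hr k hN

lemma integrable_of_continuous (μ : ProbabilityMeasure (Zd d → ZMod q))
    {G : (Zd d → ZMod q) → ℝ} (hG : Continuous G) :
    Integrable G (μ : Measure (Zd d → ZMod q)) :=
  (BoundedContinuousFunction.mkOfCompact ⟨G, hG⟩).integrable _

/-- Phase transition when the field is at most `J / (4 d (|x| + 1))` off a finite set. -/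
lemma exists_ne_gibbs_of_decay (hd : 2 ≤ d) (hq : 2 ≤ q) (hJ : 0 < J) (hβ : 0 ≤ β)
    (hh : ∀ x n, 0 ≤ h x n)
    (hdecay : ∀ x ∉ S, ∀ n, h x n ≤ J / (4 * d) * (1 / ((l1 x : ℝ) + 1)))
    (hr : 2 * 9 ^ d * (q : ℝ) ^ d * Real.exp (-(β * (J / 4))) ≤ 1 / 4) :
    ∃ μ₁ μ₂ : ProbabilityMeasure (Zd d → ZMod q),
      μ₁ ∈ gibbsClusterSet d q (JcoupNN d J) β h ∧
      μ₂ ∈ gibbsClusterSet d q (JcoupNN d J) β h ∧ μ₁ ≠ μ₂ := by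
  have : Fact (1 < q) := ⟨by omega⟩
  obtain ⟨μ₁, hμ₁, h1⟩ := exists_gibbs_integral_tilt_le hd hJ hβ hh hdecay hr 0
  obtain ⟨μ₂, hμ₂, h2⟩ := exists_gibbs_integral_tilt_le hd hJ hβ hh hdecay hr 1
  refine ⟨μ₁, μ₂, hμ₁, hμ₂, ?_⟩
  rintro rfl
  have cF := continuous_fieldTilt (q := q) β h S
  have c0 : Continuous fun ω => fieldTilt (q := q) β h S ω * originNe (d := d) (0 : ZMod q) ω :=
    cF.mul (continuous_originNe (d := d) (0 : ZMod q))
  have c1 : Continuous fun ω => fieldTilt (q := q) β h S ω * originNe (d := d) (1 : ZMod q) ω :=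
    cF.mul (continuous_originNe (d := d) (1 : ZMod q))
  have hle : ∫ ω, fieldTilt β h S ω ∂(μ₁ : Measure (Zd d → ZMod q)) ≤
      ∫ ω, (fieldTilt β h S ω * originNe 0 ω + fieldTilt β h S ω * originNe 1 ω)
        ∂(μ₁ : Measure (Zd d → ZMod q)) := by
    refine integral_mono (integrable_of_continuous μ₁ cF)
      (integrable_of_continuous μ₁ (c0.add c1)) fun ω => ?_
    have hpos := fieldTilt_pos β h S ω
    simp only [originNe]
    by_cases h0 : ω 0 = 0
    · rw [if_pos h0, if_neg (by rw [h0]; exact zero_ne_one)]; simp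
    · rw [if_neg h0]; split_ifs <;> linarith
  have hpos : 0 < ∫ ω, fieldTilt β h S ω ∂(μ₁ : Measure (Zd d → ZMod q)) :=
    integral_exp_pos (integrable_of_continuous μ₁ cF)
  rw [integral_add (integrable_of_continuous μ₁ c0) (integrable_of_continuous μ₁ c1)] at hle
  linarith

lemma exists_threshold_of_decay (hd : 2 ≤ d) (hq : 2 ≤ q) (hJ : 0 < J) (hh : ∀ x n, 0 ≤ h x n)
    (hdecay : ∀ x ∉ S, ∀ n, h x n ≤ J / (4 * d) * (1 / ((l1 x : ℝ) + 1))) :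
    ∃ β₀ : ℝ, 0 < β₀ ∧ ∀ β : ℝ, β₀ < β →
      ∃ μ₁ μ₂ : ProbabilityMeasure (Zd d → ZMod q),
        μ₁ ∈ gibbsClusterSet d q (JcoupNN d J) β h ∧
        μ₂ ∈ gibbsClusterSet d q (JcoupNN d J) β h ∧ μ₁ ≠ μ₂ := by
  have hq1 : (1 : ℝ) ≤ q := by exact_mod_cast (by omega : 1 ≤ q)
  set K : ℝ := 8 * 9 ^ d * (q : ℝ) ^ d with hK
  have hK1 : 1 < K := by
    have h1 : (1 : ℝ) ≤ 9 ^ d := one_le_pow₀ (by norm_num)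
    have h2 : (1 : ℝ) ≤ (q : ℝ) ^ d := one_le_pow₀ hq1
    nlinarith [one_le_mul_of_one_le_of_one_le h1 h2]
  refine ⟨4 / J * Real.log K, mul_pos (by positivity) (Real.log_pos hK1), fun β hβ => ?_⟩
  have hβ0 : 0 < β := (mul_pos (by positivity) (Real.log_pos hK1)).trans hβ
  refine exists_ne_gibbs_of_decay hd hq hJ hβ0.le hh hdecay ?_
  have hlog : Real.log K ≤ β * (J / 4) := by
    have := mul_le_mul_of_nonneg_right hβ.le (by positivity : 0 ≤ J / 4)
    calc Real.log K = 4 / J * Real.log K * (J / 4) := by field_simp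
      _ ≤ _ := this
  have hexp : Real.exp (-(β * (J / 4))) ≤ K⁻¹ := by
    rw [Real.exp_neg]
    exact inv_anti₀ (by linarith) ((Real.le_exp_log K).trans (Real.exp_le_exp.2 hlog))
  calc 2 * 9 ^ d * (q : ℝ) ^ d * Real.exp (-(β * (J / 4)))
      ≤ 2 * 9 ^ d * (q : ℝ) ^ d * K⁻¹ := by gcongr
    _ = 1 / 4 := by rw [hK]; field_simp; norm_num

end Limit

lemma one_le_l1 {d : ℕ} {x : Zd d} (hx : x ≠ 0) : 1 ≤ l1 x := by
  obtain ⟨i, hi⟩ := Function.ne_iff.1 hx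
  exact (Int.one_le_abs hi).trans (abs_apply_le_l1 x i)


/-- **Phase transition for the nearest-neighbour Potts model with a decaying field**
(Corollary 1.4). (i) If the nonnegative field `h` is bounded by `h*/|x|^δ` with
`δ > 1`, then for `β` large enough the set `𝒢_{β,h}` of weak cluster points of
finite-volume Gibbs measures contains two distinct measures. (ii) If the decay
exponent is exactly `1`, the same holds provided `h*` is small enough. -/
theorem potts_decaying_field_nearest_neighbour
    (d q : ℕ) (hd : 2 ≤ d) [NeZero q] (hq : 2 ≤ q) (J : ℝ) (hJ : 0 < J) :
    ((∀ h : Zd d → ZMod q → ℝ, (∀ x n, 0 ≤ h x n) →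
      ∀ hstar : ℝ, 0 ≤ hstar → ∀ δ : ℝ, 1 < δ →
      (∀ x : Zd d, x ≠ 0 → ∀ n : ZMod q, h x n ≤ hstar / (l1 x : ℝ) ^ δ) →
      ∃ β₀ : ℝ, 0 < β₀ ∧ ∀ β : ℝ, β₀ < β →
        ∃ μ₁ μ₂ : ProbabilityMeasure (Zd d → ZMod q),
          μ₁ ∈ gibbsClusterSet d q (JcoupNN d J) β h ∧
          μ₂ ∈ gibbsClusterSet d q (JcoupNN d J) β h ∧ μ₁ ≠ μ₂)
    ∧
    (∃ h₀ : ℝ, 0 < h₀ ∧ ∀ h : Zd d → ZMod q → ℝ, (∀ x n, 0 ≤ h x n) →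
      ∀ hstar : ℝ, 0 ≤ hstar → hstar ≤ h₀ →
      (∀ x : Zd d, x ≠ 0 → ∀ n : ZMod q, h x n ≤ hstar / (l1 x : ℝ)) →
      ∃ β₀ : ℝ, 0 < β₀ ∧ ∀ β : ℝ, β₀ < β →
        ∃ μ₁ μ₂ : ProbabilityMeasure (Zd d → ZMod q),
          μ₁ ∈ gibbsClusterSet d q (JcoupNN d J) β h ∧
          μ₂ ∈ gibbsClusterSet d q (JcoupNN d J) β h ∧ μ₁ ≠ μ₂)) := by
  have hd0 : (0 : ℝ) < d := by exact_mod_cast (by omega : 0 < d)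
  refine ⟨fun h hh hstar hstar0 δ hδ hdecay => ?_, J / (8 * d), by positivity,
    fun h hh hstar hstar0 hle hdecay => ?_⟩
  · obtain ⟨R, hR⟩ := ((tendsto_rpow_atTop (sub_pos.2 hδ)).comp
      tendsto_natCast_atTop_atTop).eventually_ge_atTop (8 * d * hstar / J) |>.exists_forall_of_atTop
    refine exists_threshold_of_decay (S := box d R) hd hq hJ hh fun x hx n => ?_
    have hRx : (R : ℤ) < l1 x := by
      rw [mem_box] at hx
      push Not at hx
      obtain ⟨i, hi⟩ := hx
      exact hi.trans_le (abs_apply_le_l1 x i)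
    have hx1 : 1 ≤ l1 x := by omega
    have hx1' : (1 : ℝ) ≤ l1 x := by exact_mod_cast hx1
    have hx0 : x ≠ 0 := by rintro rfl; simp [l1] at hx1
    refine (hdecay x hx0 n).trans ?_
    have hcast : (((l1 x).toNat : ℕ) : ℝ) = l1 x := by
      exact_mod_cast Int.toNat_of_nonneg (l1_nonneg x)
    have hpow := hR (l1 x).toNat (by omega)
    simp only [Function.comp_apply] at hpow
    rw [hcast, div_le_iff₀ hJ] at hpow
    have hsplit : (l1 x : ℝ) ^ δ = (l1 x : ℝ) ^ (δ - 1) * l1 x := by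
      rw [← Real.rpow_add_one (by linarith), sub_add_cancel]
    rw [hsplit, div_mul_div_comm, mul_one, div_le_div_iff₀ (by positivity) (by positivity)]
    nlinarith [mul_nonneg (sub_nonneg.2 hpow) (by linarith : (0 : ℝ) ≤ l1 x),
      mul_nonneg (mul_nonneg hstar0 hd0.le) (sub_nonneg.2 hx1')]
  · refine exists_threshold_of_decay (S := {0}) hd hq hJ hh fun x hx n => ?_
    have hx0 : x ≠ 0 := by simpa using hx
    have hx1 : (1 : ℝ) ≤ l1 x := by exact_mod_cast one_le_l1 hx0
    refine (hdecay x hx0 n).trans ?_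
    rw [le_div_iff₀ (by positivity)] at hle
    rw [div_mul_div_comm, mul_one, div_le_div_iff₀ (by positivity) (by positivity)]
    nlinarith [mul_nonneg (sub_nonneg.2 hle) (by linarith : (0 : ℝ) ≤ l1 x),
      mul_nonneg (mul_nonneg hstar0 hd0.le) (sub_nonneg.2 hx1)]
end
end

section
/- Let d ≥ 1, q ≥ 2, J > 0, α ≥ 0, and let ψ : ZMod q → ℝ satisfy ψ(0) = 0, ψ(n) ≥ 0 for all n, and ψ(n) ≥ m for all n ≠ 0, where m ≥ 0. Let σ : ℤ^d → ZMod q, let S ⊂ ℤ^d be a finite set such that every point of S is incorrect for σ, and such that for every z ∈ S every incorrect point lying in B₁(z) also belongs to S. Then for every y ∈ ℤ^d: ∑_{x∈S} ∑_{x'∈B₁(x)} J_{x'y}·ψ(σ_x − σ_y) ≥ m·∑_{z∈S} J_{zy}. -/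
open scoped BigOperators

noncomputable section

/-- The closed ℓ¹-ball of radius 1 centred at `x` (a finite set of `2d+1` points). -/
def ball1 {d : ℕ} (x : Zd d) : Finset (Zd d) :=
  ((Fintype.piFinset fun _ : Fin d => ({-1, 0, 1} : Finset ℤ)).image (fun v => x + v)).filter
    (fun y => l1 (y - x) ≤ 1)

/-- Long-range couplings `J_{xy} = J / |x-y|^α` for `x ≠ y`, and `J_{xx} = 0`. -/
noncomputable def Jcoup (d : ℕ) (J α : ℝ) (x y : Zd d) : ℝ :=
  if x = y then 0 else J / ((l1 (x - y) : ℝ) ^ α)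

/-- A point `x` is `r`-correct for `σ` if `σ` equals `r` on the whole unit ball `B₁(x)`. -/
def IsCorrect {d q : ℕ} (σ : Zd d → ZMod q) (r : ZMod q) (x : Zd d) : Prop :=
  ∀ y ∈ ball1 x, σ y = r

/-- A point is incorrect for `σ` if it is `r`-correct for no colour `r`. -/
def IsIncorrect {d q : ℕ} (σ : Zd d → ZMod q) (x : Zd d) : Prop :=
  ∀ r : ZMod q, ¬ IsCorrect σ r x

lemma mem_ball1_iff {d : ℕ} {x y : Zd d} : y ∈ ball1 x ↔ l1 (y - x) ≤ 1 := by
  simp only [ball1, Finset.mem_filter, Finset.mem_image, and_iff_right_iff_imp]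
  refine fun h => ⟨y - x, Fintype.mem_piFinset.2 fun i => ?_, add_sub_cancel x y⟩
  have hi : |(y - x) i| ≤ 1 :=
    (Finset.single_le_sum (fun j _ => abs_nonneg ((y - x) j)) (Finset.mem_univ i)).trans h
  simp only [Finset.mem_insert, Finset.mem_singleton]
  rw [abs_le] at hi
  omega

lemma self_mem_ball1 {d : ℕ} (x : Zd d) : x ∈ ball1 x := by
  simp [mem_ball1_iff, l1]

lemma mem_ball1_comm {d : ℕ} {x y : Zd d} : y ∈ ball1 x ↔ x ∈ ball1 y := by
  simp only [mem_ball1_iff, l1, Pi.sub_apply, abs_sub_comm]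

lemma Jcoup_nonneg {d : ℕ} {J : ℝ} (hJ : 0 ≤ J) (α : ℝ) (x y : Zd d) : 0 ≤ Jcoup d J α x y := by
  have h : (0 : ℝ) ≤ (l1 (x - y) : ℝ) :=
    Int.cast_nonneg (Finset.sum_nonneg fun i _ => abs_nonneg _)
  unfold Jcoup
  split_ifs
  · exact le_rfl
  · positivity

/-- A point having a neighbour of a different colour is incorrect. -/
lemma IsIncorrect.of_mem_ball1 {d q : ℕ} {σ : Zd d → ZMod q} {x y : Zd d} (hy : y ∈ ball1 x)
    (hne : σ x ≠ σ y) : IsIncorrect σ x :=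
  fun _ hr => hne ((hr x (self_mem_ball1 x)).trans (hr y hy).symm)

/-- Around an incorrect point, every colour is avoided by some incorrect point. -/
lemma IsIncorrect.exists_mem_ball1_ne {d q : ℕ} {σ : Zd d → ZMod q} {z : Zd d}
    (hz : IsIncorrect σ z) (r : ZMod q) : ∃ x ∈ ball1 z, IsIncorrect σ x ∧ σ x ≠ r := by
  by_cases h : σ z = r
  · obtain ⟨x, hx, hne⟩ : ∃ x ∈ ball1 z, σ x ≠ r := by
      simpa only [IsCorrect, not_forall, exists_prop] using hz r
    exact ⟨x, hx, .of_mem_ball1 (mem_ball1_comm.1 hx) (h ▸ hne), hne⟩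
  · exact ⟨z, self_mem_ball1 z, hz, h⟩

/-- **Energy of incorrect points** (Lemma 4.2): if every point of the finite set `S`
is incorrect for `σ` and `S` contains every incorrect point lying in a unit ball
around one of its points, then for every `y`,
`∑_{x∈S} ∑_{x'∈B₁(x)} J_{x'y}·ψ(σ_x-σ_y) ≥ m·∑_{z∈S} J_{zy}`. -/
theorem incorrect_points_energy_bound
    (d q : ℕ) (hd : 1 ≤ d) (hq : 2 ≤ q) (J α m : ℝ) (hJ : 0 < J) (hα : 0 ≤ α) (hm : 0 ≤ m)
    (ψ : ZMod q → ℝ) (hψ0 : ψ 0 = 0) (hψnonneg : ∀ n, 0 ≤ ψ n)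
    (hψm : ∀ n : ZMod q, n ≠ 0 → m ≤ ψ n)
    (σ : Zd d → ZMod q) (S : Finset (Zd d))
    (hinc : ∀ z ∈ S, IsIncorrect σ z)
    (hclosed : ∀ z ∈ S, ∀ w ∈ ball1 z, IsIncorrect σ w → w ∈ S)
    (y : Zd d) :
    m * ∑ z ∈ S, Jcoup d J α z y
      ≤ ∑ x ∈ S, ∑ x' ∈ ball1 x, Jcoup d J α x' y * ψ (σ x - σ y) := by
  have hterm (x x' : Zd d) : 0 ≤ Jcoup d J α x' y * ψ (σ x - σ y) :=
    mul_nonneg (Jcoup_nonneg hJ.le α x' y) (hψnonneg _)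
  calc m * ∑ z ∈ S, Jcoup d J α z y
      = ∑ z ∈ S, Jcoup d J α z y * m := by rw [mul_comm, Finset.sum_mul]
    _ ≤ ∑ z ∈ S, ∑ x ∈ S with z ∈ ball1 x, Jcoup d J α z y * ψ (σ x - σ y) := by
        refine Finset.sum_le_sum fun z hz => ?_
        obtain ⟨x, hx, hxinc, hne⟩ := (hinc z hz).exists_mem_ball1_ne (σ y)
        have hmem : x ∈ S.filter fun x => z ∈ ball1 x :=
          Finset.mem_filter.2 ⟨hclosed z hz x hx hxinc, mem_ball1_comm.1 hx⟩
        exact (mul_le_mul_of_nonneg_left (hψm _ (sub_ne_zero.2 hne))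
          (Jcoup_nonneg hJ.le α z y)).trans
            (Finset.single_le_sum (f := fun x => Jcoup d J α z y * ψ (σ x - σ y))
              (fun x _ => hterm x z) hmem)
    _ = ∑ x ∈ S, ∑ z ∈ S with z ∈ ball1 x, Jcoup d J α z y * ψ (σ x - σ y) :=
        Finset.sum_comm' fun z x => by simp only [Finset.mem_filter]; tauto
    _ ≤ ∑ x ∈ S, ∑ x' ∈ ball1 x, Jcoup d J α x' y * ψ (σ x - σ y) :=
        Finset.sum_le_sum fun x _ => Finset.sum_le_sum_of_subset_of_nonneg
          (fun z hz => (Finset.mem_filter.1 hz).2) fun x' _ _ => hterm x x'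
end
end
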